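/- (Hougardy–Lutz–Zelke) Every orientable triangulated surface with exactly 10 vertices and Euler characteristic −4 (i.e., every one of the 20 vertex-minimal triangulations of the orientable surface of genus 3) admits a geometric realization in ℝ³. -/

import Mathlib

open scoped Classical

/-- A triangulated surface on the vertex set `Fin n`: a finite 2-dimensional simplicial
complex given by its set of triangles, which is connected, in which every vertex lies in
some triangle, every edge lies in exactly two triangles, and the link of every vertex is
a single cycle (encoded as: the link graph of every vertex is connected; together with the
condition that every edge lies in exactly two triangles this makes every vertex link a
single circle). -/
structure TriSurface (n : ℕ) where
  faces : Finset (Finset (Fin n))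
  card_eq : ∀ f ∈ faces, f.card = 3
  vertex_mem : ∀ v : Fin n, ∃ f ∈ faces, v ∈ f
  edge_two : ∀ u v : Fin n, u ≠ v → (∃ f ∈ faces, u ∈ f ∧ v ∈ f) →
      (faces.filter (fun f => u ∈ f ∧ v ∈ f)).card = 2
  conn : ∀ u v : Fin n,
      Relation.ReflTransGen (fun a b : Fin n => ∃ f ∈ faces, a ∈ f ∧ b ∈ f) u v
  link_cycle : ∀ v a b : Fin n,
      (∃ f ∈ faces, v ∈ f ∧ a ∈ f ∧ a ≠ v) →
      (∃ f ∈ faces, v ∈ f ∧ b ∈ f ∧ b ≠ v) →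
      Relation.ReflTransGen
        (fun x y : Fin n => x ≠ y ∧ x ≠ v ∧ y ≠ v ∧ ({v, x, y} : Finset (Fin n)) ∈ faces)
        a b

/-- The edges of a triangulated surface: all 2-element vertex sets contained in a triangle. -/
noncomputable def TriSurface.edges {n : ℕ} (S : TriSurface n) : Finset (Finset (Fin n)) :=
  Finset.univ.filter (fun e => e.card = 2 ∧ ∃ f ∈ S.faces, e ⊆ f)

/-- The Euler characteristic χ = f₀ - f₁ + f₂ of a triangulated surface. -/
noncomputable def TriSurface.eulerChar {n : ℕ} (S : TriSurface n) : ℤ :=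
  (n : ℤ) - (S.edges.card : ℤ) + (S.faces.card : ℤ)

/-- Combinatorial isomorphism: a bijection of the vertices mapping triangles to triangles. -/
def TriSurface.Iso {n : ℕ} (S T : TriSurface n) : Prop :=
  ∃ σ : Equiv.Perm (Fin n), ∀ f : Finset (Fin n), f ∈ S.faces ↔ f.image σ ∈ T.faces

/-- Orientability: each triangle can be given a cyclic orientation (recorded as the set of
its three induced directed edges) such that the two orientations induced on each edge by
the two triangles containing it are opposite (no directed edge is induced twice). -/
def TriSurface.Orientable {n : ℕ} (S : TriSurface n) : Prop :=
  ∃ ω : Finset (Fin n) → Finset (Fin n × Fin n),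
    (∀ f ∈ S.faces, ∃ a b c : Fin n, a ≠ b ∧ a ≠ c ∧ b ≠ c ∧
        f = {a, b, c} ∧ ω f = {(a, b), (b, c), (c, a)}) ∧
    (∀ f ∈ S.faces, ∀ g ∈ S.faces, f ≠ g → ∀ p ∈ ω f, p ∉ ω g)

/-- The edge `uv` is contractible: the only common neighbours of `u` and `v` are the two
vertices `w`, `z` with `uvw`, `uvz` triangles, and the edge `wz` is not contained in both
the link of `u` and the link of `v`. -/
def TriSurface.Contractible {n : ℕ} (S : TriSurface n) (u v : Fin n) : Prop :=
  ({u, v} : Finset (Fin n)) ∈ S.edges ∧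
  (∀ w : Fin n, w ≠ u → w ≠ v →
      ({u, w} : Finset (Fin n)) ∈ S.edges → ({v, w} : Finset (Fin n)) ∈ S.edges →
      ({u, v, w} : Finset (Fin n)) ∈ S.faces) ∧
  ¬ ∃ w z : Fin n, ({u, v, w} : Finset (Fin n)) ∈ S.faces ∧
      ({u, v, z} : Finset (Fin n)) ∈ S.faces ∧ w ≠ z ∧
      ({u, w, z} : Finset (Fin n)) ∈ S.faces ∧ ({v, w, z} : Finset (Fin n)) ∈ S.faces

/-- A triangulated surface is irreducible if it has no contractible edge. -/
def TriSurface.Irreducible {n : ℕ} (S : TriSurface n) : Prop :=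
  ¬ ∃ u v : Fin n, S.Contractible u v

/-- The simplices of the complex: the nonempty subsets of triangles. -/
def TriSurface.IsSimplex {n : ℕ} (S : TriSurface n) (σ : Finset (Fin n)) : Prop :=
  σ.Nonempty ∧ ∃ f ∈ S.faces, σ ⊆ f

/-- A geometric realization in ℝ³: each triangle is mapped to affinely independent points,
and the convex hulls of the point sets of any two simplices of the complex intersect
exactly in the convex hull of the points of their common vertices. -/
def TriSurface.IsRealization {n : ℕ} (S : TriSurface n) (p : Fin n → (Fin 3 → ℝ)) : Prop :=
  (∀ f ∈ S.faces, AffineIndependent ℝ (fun x : {x // x ∈ f} => p x.1)) ∧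
  ∀ σ τ : Finset (Fin n), S.IsSimplex σ → S.IsSimplex τ →
    convexHull ℝ (p '' ↑σ) ∩ convexHull ℝ (p '' ↑τ) = convexHull ℝ (p '' ↑(σ ∩ τ))

/-- Neighborly: every pair of distinct vertices forms an edge. -/
def TriSurface.Neighborly {n : ℕ} (S : TriSurface n) : Prop :=
  ∀ u v : Fin n, u ≠ v → ({u, v} : Finset (Fin n)) ∈ S.edges

namespace TriSearch

/-! ### Bit-packed partial rotation systems -/

/-- The entry of the table `s` at the dart `(a, b)`: `0` if nothing is known about it, `c + 1` if
`(a, b, c)` is an oriented triangle, and at least `11` if `ab` is not an edge. -/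
def entry (s a b : ℕ) : ℕ :=
  Nat.land (Nat.shiftRight s (Nat.mul 4 (Nat.add (Nat.mul 10 a) b))) 15

/-- Write `x` at the dart `(a, b)` of the table `s`. -/
def put (s a b x : ℕ) : ℕ :=
  Nat.lor s (Nat.shiftLeft x (Nat.mul 4 (Nat.add (Nat.mul 10 a) b)))

/-- Add the oriented triangle `(a, b, c)` to the table `s`. -/
def place (s a b c : ℕ) : ℕ := put (put (put s a b (c + 1)) b c (a + 1)) c a (b + 1)

/-- The table `s` does not rule out that the dart `(a, b)` is followed by `c`. -/
def compat (s a b c : ℕ) : Bool :=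
  Nat.rec true (fun n _ => Nat.beq n c) (entry s a b)

/-- The `v`-th hexadecimal digit of `d`. -/
def digit (d v : ℕ) : ℕ := Nat.land (Nat.shiftRight d (Nat.mul 4 v)) 15

/-- Following the known part of the link of `v` from `z`, one meets `x` in less than the given
number of steps. -/
noncomputable def closes (s v x k : ℕ) : ℕ → Bool :=
  Nat.rec (fun _ => false) (fun _ ih z => bif Nat.beq z x then true else
    Nat.rec false (fun w _ => ih w) (entry s v z)) k

/-- The triangle `(v, x, y)` does not close the link of `v` into a cycle that is too short. -/
noncomputable def linkOK (d s v x y : ℕ) : Bool :=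
  !closes s v x (Nat.sub (digit d v) 1) y

/-- Evaluate `x` before passing it on. -/
noncomputable def force {α : Type} (x : ℕ) (f : ℕ → α) : α :=
  Nat.rec (f 0) (fun n _ => f n) (Nat.succ x)

/-- Membership of a natural number in a list. -/
def memB (m : ℕ) (l : List ℕ) : Bool := l.any (Nat.beq m)

/-- The bit mask of the image of `{a, b, c}` under the vertex map encoded by `π`. -/
def triMask (π a b c : ℕ) : ℕ :=
  Nat.lor (Nat.lor (Nat.shiftLeft 1 (digit π a)) (Nat.shiftLeft 1 (digit π b)))
    (Nat.shiftLeft 1 (digit π c))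

/-- The vertex map encoded by `π` is injective on the ten vertices. -/
def permOK (π : ℕ) : Bool :=
  (List.range 10).all fun i => Nat.blt (digit π i) 10 &&
    (List.range i).all fun k => !Nat.beq (digit π k) (digit π i)

/-- The table `s` is complete and `π` maps its triangles to triangles of the given list. -/
noncomputable def leafOK (tris : List ℕ) (s π : ℕ) : Bool :=
  permOK π && (List.range 10).all fun a => (List.range 10).all fun b =>
    force (entry s a b) fun c => Nat.blt 0 c &&
      (Nat.blt 10 c || force (triMask π a b (c - 1)) fun m => memB m tris)

/-- Try all third vertices for the dart `(a, b)`, threading the advice `o` through the calls. -/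
noncomputable def tryAll (rec : ℕ → ℕ → ℕ) (d s a b : ℕ) (l : List ℕ) : ℕ → ℕ :=
  List.rec (fun o => o) (fun c _ ih o =>
    bif compat s b c a && compat s c a b then
      force (place s a b c) fun s' =>
        bif linkOK d s' a b c && linkOK d s' b c a && linkOK d s' c a b then force (rec s' o) ih
        else ih o
    else ih o) l

/-- Complete the table `s` in all possible ways and recognize every result among the templates
`Ts`. The advice `o`, in base `128`, names the dart to branch on or the template reached; the
unused advice is returned, and `0` on failure. -/
noncomputable def search (Ts : List (List ℕ)) (d k : ℕ) : ℕ → ℕ → ℕ :=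
  Nat.rec (fun _ _ => 0) (fun _ ih s o =>
    bif Nat.beq o 0 then 0 else force (o % 128) fun x => force (o / 128) fun o' =>
      bif Nat.blt x 100 then
        force (x / 10) fun a => force (x % 10) fun b =>
          bif Nat.beq (entry s a b) 0 then
            tryAll ih d s a b [0, 1, 2, 3, 4, 5, 6, 7, 8, 9] o'
          else 0
      else force (o' % 2 ^ 42) fun π =>
        bif leafOK (Ts.getD (x - 100) []) s π then o' / 2 ^ 42 else 0) k

/-! ### Roots of the search -/

/-- The vertex after `i` in the link `1, …, 9` of the vertex `0`. -/
def nxt (i : ℕ) : ℕ := i % 9 + 1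

/-- The pairs of vertices that are not yet edges after placing the star of the vertex `0`. -/
def chords : List (ℕ × ℕ) :=
  [(1, 3), (1, 4), (1, 5), (1, 6), (1, 7), (1, 8), (2, 4), (2, 5), (2, 6), (2, 7), (2, 8), (2, 9),
    (3, 5), (3, 6), (3, 7), (3, 8), (3, 9), (4, 6), (4, 7), (4, 8), (4, 9), (5, 7), (5, 8), (5, 9),
    (6, 8), (6, 9), (7, 9)]

/-- Rotation of the nine vertices other than `0`. -/
def rot (r x : ℕ) : ℕ := bif Nat.beq x 0 then 0 else (x - 1 + r) % 9 + 1

/-- Reflection of the nine vertices other than `0`. -/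
def reflect (r x : ℕ) : ℕ := bif Nat.beq x 0 then 0 else (r + 9 - x) % 9 + 1

/-- The weight of a pair of vertices. -/
def weight (a b : ℕ) : ℕ := 2 ^ (10 * a + b) + 2 ^ (10 * b + a)

/-- The total weight of the image of `l` under `g`. -/
def key (g : ℕ → ℕ) (l : List (ℕ × ℕ)) : ℕ :=
  (l.map fun e => weight (g e.1) (g e.2)).sum

/-- Some rotation or reflection decreases the total weight of `l`. -/
noncomputable def reducible (l : List (ℕ × ℕ)) : Bool :=
  force (key id l) fun n => (List.range 9).any fun r =>
    Nat.blt (key (rot r) l) n || Nat.blt (key (reflect r) l) n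

/-- The table with the star of the vertex `0` in which exactly the pairs in `l` are non-edges. -/
def initial (l : List (ℕ × ℕ)) : ℕ :=
  let s := (List.range 10).foldl (fun s v => put s v v 11) 0
  let s := (List.range 9).foldl (fun s i => place s 0 (i + 1) (nxt (i + 1))) s
  l.foldl (fun s e => put (put s e.1 e.2 11) e.2 e.1 11) s

/-- The vertex degrees when exactly the pairs in `l` are non-edges. -/
def degrees (l : List (ℕ × ℕ)) : ℕ :=
  659706976665 - (l.map fun e => 16 ^ e.1 + 16 ^ e.2).sum

/-- The digits of `d` are lower bounds for the numbers of possible neighbors in the table `s`. -/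
def degreesOK (d s : ℕ) : Bool :=
  (List.range 10).all fun v =>
    Nat.ble (digit d v) ((List.range 10).countP fun w => Nat.blt (entry s v w) 11)

/-- The search succeeds when exactly the pairs in `l` are non-edges. -/
noncomputable def rootOK (Ts : List (List ℕ)) (l : List (ℕ × ℕ)) (o : ℕ) : Bool :=
  force (initial l) fun s => force (degrees l) fun d =>
    degreesOK d s && Nat.blt 0 (search Ts d 25 s o)

/-- The sublists of `l` of length `k`. -/
def choose {α : Type} : ℕ → List α → List (List α)
  | 0, _ => [[]]
  | _ + 1, [] => []
  | k + 1, x :: l => (choose k l).map (List.cons x) ++ choose (k + 1) l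

/-- Every entry of the list either is reducible or passes the search with the next advice. -/
noncomputable def rootsOK (Ts : List (List ℕ)) : List (List (ℕ × ℕ)) → List ℕ → Bool
  | [], _ => true
  | l :: ls, os => bif reducible l then rootsOK Ts ls os else
      match os with
      | [] => false
      | o :: os => rootOK Ts l o && rootsOK Ts ls os

/-! ### Checking the templates -/

/-- A realized triangulated surface: its triangles (as bit masks), the coordinates of its vertices
(in base `64`), and planes. The binary digits of a plane are, in this order: the masks of the
vertices on its two sides and on the plane itself (10 digits each), its shifted coefficients `a`,
`b`, `c` (10 digits each) and its shifted offset. -/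
structure Template where
  tris : List ℕ
  pts : ℕ
  planes : List ℕ

/-- The coordinates of the points of `T`. -/
def Template.coord (T : Template) (v i : ℕ) : ℕ := T.pts / 64 ^ (3 * v + i) % 64

/-- The masks of the plane `q` describe its position relative to the point with index `v` and
coordinates `x`, `y`, `z`. -/
def sideOK (q v x y z : ℕ) : Bool :=
  let s := q / 2 ^ 30 % 1024 * x + q / 2 ^ 40 % 1024 * y + q / 2 ^ 50 % 1024 * z + 131072
  let t := q / 2 ^ 60 + 512 * (x + y + z)
  (!q.testBit v || Nat.blt t s) && (!q.testBit (10 + v) || Nat.blt s t) &&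
    (!q.testBit (20 + v) || Nat.beq s t)

/-- The masks of the plane `q` are correct. -/
noncomputable def Template.planeOK (T : Template) (q : ℕ) : Bool :=
  (List.range 10).all fun v => force (T.coord v 0) fun x => force (T.coord v 1) fun y =>
    force (T.coord v 2) fun z => sideOK q v x y z

/-- The mask of a plane that separates `F` from `G` away from their common vertices. -/
def sepMask (F G : ℕ) : ℕ :=
  (F ^^^ (F &&& G)) ||| (G ^^^ (F &&& G)) <<< 10 ||| (F &&& G) <<< 20

/-- Some plane in the list has all digits of `m` or all digits of `n`. -/
def covers (l : List ℕ) (m n : ℕ) : Bool :=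
  l.any fun q => Nat.beq (Nat.land q m) m || Nat.beq (Nat.land q n) n

/-- Some plane of `T` separates `F` and `G`. -/
noncomputable def Template.pairOK (T : Template) (F G : ℕ) : Bool :=
  force (sepMask F G) fun m => force (sepMask G F) fun n => covers T.planes m n

/-- Any two triangles in the list are separated by a plane of `T`. -/
noncomputable def Template.pairsOK (T : Template) : List ℕ → Bool
  | [] => true
  | F :: l => l.all (T.pairOK F) && T.pairsOK l

/-- The triangles of `T` form a geometric realization. -/
noncomputable def Template.ok (T : Template) : Bool := T.planes.all T.planeOK && T.pairsOK T.tris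

/-! ### Rotation systems -/

/-- A relation `O a b c`, meaning that `(a, b, c)` is an oriented triangle, that describes a closed
oriented surface with vertices below `10`. -/
structure IsRot (O : ℕ → ℕ → ℕ → Prop) : Prop where
  lt : ∀ {a b c}, O a b c → a < 10
  cyc : ∀ {a b c}, O a b c → O b c a
  ne : ∀ {a b c}, O a b c → a ≠ b
  uniq : ∀ {a b c d}, O a b c → O a b d → c = d
  opp : ∀ {a b c}, O a b c → ∃ d, O b a d
  link : ∀ (v : ℕ) (A : Finset ℕ), A.Nonempty → (∀ x ∈ A, ∃ y ∈ A, O v x y) →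
    ∀ {x y}, O v x y → x ∈ A

/-- The vertices `a` and `b` are joined by an edge. -/
def Adj (O : ℕ → ℕ → ℕ → Prop) (a b : ℕ) : Prop := ∃ c, O a b c

/-- The bit mask of `{x, y, z}`. -/
def mask (x y z : ℕ) : ℕ :=
  Nat.lor (Nat.lor (Nat.shiftLeft 1 x) (Nat.shiftLeft 1 y)) (Nat.shiftLeft 1 z)

/-- The surface described by `O` embeds into one of the complexes in `Ts`. -/
def Models (Ts : List (List ℕ)) (O : ℕ → ℕ → ℕ → Prop) : Prop :=
  ∃ T ∈ Ts, ∃ σ : ℕ → ℕ, (∀ i < 10, σ i < 10) ∧ (∀ i < 10, ∀ j < 10, σ i = σ j → i = j) ∧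
    ∀ a b c, O a b c → mask (σ a) (σ b) (σ c) ∈ T

namespace IsRot

variable {O : ℕ → ℕ → ℕ → Prop}

theorem lt₂ (hO : IsRot O) {a b c : ℕ} (h : O a b c) : b < 10 := hO.lt (hO.cyc h)

theorem lt₃ (hO : IsRot O) {a b c : ℕ} (h : O a b c) : c < 10 := hO.lt₂ (hO.cyc h)

theorem adj_symm (hO : IsRot O) {a b : ℕ} (h : Adj O a b) : Adj O b a := hO.opp h.choose_spec

end IsRot

/-! ### Soundness of the search -/

theorem force_eq {α : Type} (x : ℕ) (f : ℕ → α) : force x f = f x := rfl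

theorem entry_put (s : ℕ) {a b x a' b' : ℕ} (hb : b < 10) (hx : x < 16) (hb' : b' < 10) :
    entry (put s a b x) a' b' = if a = a' ∧ b = b' then entry s a b ||| x else entry s a' b' := by
  change ((s ||| (x <<< (4 * (10 * a + b)))) >>> (4 * (10 * a' + b'))) &&& 15 =
    if a = a' ∧ b = b' then ((s >>> (4 * (10 * a + b))) &&& 15) ||| x
    else (s >>> (4 * (10 * a' + b'))) &&& 15
  have key : ∀ {y i : ℕ}, y < 16 → 4 ≤ i → y.testBit i = false := fun {y i} hy hi =>
    Nat.testBit_lt_two_pow (hy.trans_le (Nat.pow_le_pow_right (by norm_num) hi : 2 ^ 4 ≤ 2 ^ i))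
  apply Nat.eq_of_testBit_eq
  intro i
  split_ifs with h
  · obtain ⟨rfl, rfl⟩ := h
    simp only [Nat.testBit_and, Nat.testBit_shiftRight, Nat.testBit_or, Nat.testBit_shiftLeft]
    by_cases hi : i < 4
    · have : Nat.testBit 15 i = true := by interval_cases i <;> rfl
      simp [this]
    · simp [key (y := 15) (by norm_num) (not_lt.1 hi), key hx (not_lt.1 hi)]
  · simp only [Nat.testBit_and, Nat.testBit_shiftRight, Nat.testBit_or, Nat.testBit_shiftLeft]
    by_cases hi : i < 4
    · have : (decide (4 * (10 * a' + b') + i ≥ 4 * (10 * a + b)) &&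
          x.testBit (4 * (10 * a' + b') + i - 4 * (10 * a + b))) = false := by
        rw [Bool.and_eq_false_iff]
        by_cases h1 : 4 * (10 * a' + b') + i ≥ 4 * (10 * a + b)
        · right
          apply key hx
          omega
        · left; simpa using h1
      rw [this, Bool.or_false]
    · simp [key (y := 15) (by norm_num) (not_lt.1 hi)]

/-- The table `s` contains only true information about `O`. -/
def Agrees (O : ℕ → ℕ → ℕ → Prop) (s : ℕ) : Prop :=
  ∀ a < 10, ∀ b < 10, (entry s a b = 0 → Adj O a b) ∧
    (∀ c < 10, entry s a b = c + 1 → O a b c) ∧ (11 ≤ entry s a b → ¬ Adj O a b)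

section

variable {O : ℕ → ℕ → ℕ → Prop} {s : ℕ}

theorem Agrees.entry_eq (hO : IsRot O) (hs : Agrees O s) {a b c : ℕ} (h : O a b c) :
    entry s a b = 0 ∨ entry s a b = c + 1 := by
  obtain ⟨-, h2, h3⟩ := hs a (hO.lt h) b (hO.lt₂ h)
  rcases hn : entry s a b with _ | n
  · exact Or.inl rfl
  · right
    have : n < 10 := by
      by_contra hlt
      exact h3 (by omega) ⟨c, h⟩
    rw [hO.uniq h (h2 n this hn)]

theorem Agrees.put (hO : IsRot O) (hs : Agrees O s) {a b c : ℕ} (h : O a b c) :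
    Agrees O (put s a b (c + 1)) := by
  intro a' ha' b' hb'
  have hc := hO.lt₃ h
  rw [entry_put s (hO.lt₂ h) (by omega) hb']
  split_ifs with h'
  · obtain ⟨rfl, rfl⟩ := h'
    have : entry s a b ||| (c + 1) = c + 1 := by
      rcases hs.entry_eq hO h with h | h <;> simp [h]
    rw [this]
    refine ⟨by omega, fun c' _ hcc => ?_, by omega⟩
    obtain rfl : c = c' := by omega
    exact h
  · exact hs a' ha' b' hb'

theorem Agrees.place (hO : IsRot O) (hs : Agrees O s) {a b c : ℕ} (h : O a b c) :
    Agrees O (place s a b c) :=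
  ((hs.put hO h).put hO (hO.cyc h)).put hO (hO.cyc (hO.cyc h))

theorem Agrees.compat (hO : IsRot O) (hs : Agrees O s) {a b c : ℕ} (h : O a b c) :
    compat s a b c = true := by
  unfold TriSearch.compat
  rcases hs.entry_eq hO h with h | h <;> rw [h]
  · rfl
  · exact Nat.beq_refl c

/-- The neighbors of `v`. -/
noncomputable def nbrs (O : ℕ → ℕ → ℕ → Prop) (v : ℕ) : Finset ℕ :=
  (Finset.range 10).filter (Adj O v)

theorem Agrees.exists_of_closes (hO : IsRot O) (hs : Agrees O s) {v x : ℕ} (k : ℕ) :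
    ∀ z, Adj O v z → closes s v x k z = true →
      ∃ A : Finset ℕ, A.card ≤ k ∧ z ∈ A ∧ ∀ w ∈ A, w ≠ x → ∃ w' ∈ A, O v w w' := by
  induction k with
  | zero => intro z _ h; exact absurd h (by simp [closes])
  | succ k ih =>
    intro z hz h
    obtain ⟨w, hw⟩ := hz
    change (bif Nat.beq z x then true else
      Nat.rec false (fun w _ => closes s v x k w) (entry s v z)) = true at h
    by_cases hzx : z = x
    · exact ⟨{z}, by simp, by simp, fun w hw hne =>
        absurd ((Finset.mem_singleton.1 hw).trans hzx) hne⟩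
    · have : Nat.beq z x = false := by
        rw [← Bool.not_eq_true]; exact fun h => hzx (Nat.eq_of_beq_eq_true h)
      rw [this, cond_false] at h
      rcases hs.entry_eq hO hw with he | he <;> rw [he] at h
      · exact absurd h (by simp)
      · obtain ⟨A, hA, hwA, hcl⟩ := ih w (hO.adj_symm ⟨_, hO.cyc (hO.cyc hw)⟩) h
        refine ⟨insert z A, (Finset.card_insert_le _ _).trans (by omega),
          Finset.mem_insert_self _ _, fun u hu hne => ?_⟩
        rcases Finset.mem_insert.1 hu with rfl | hu
        · exact ⟨w, Finset.mem_insert_of_mem hwA, hw⟩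
        · obtain ⟨u', hu', h'⟩ := hcl u hu hne
          exact ⟨u', Finset.mem_insert_of_mem hu', h'⟩

theorem Agrees.linkOK (hO : IsRot O) (hs : Agrees O s) {d v x y : ℕ} (h : O v x y)
    (hd : digit d v ≤ (nbrs O v).card) : linkOK d s v x y = true := by
  unfold TriSearch.linkOK
  rw [Bool.not_eq_true', ← Bool.not_eq_true]
  intro hcl
  have hy : Adj O v y := hO.adj_symm ⟨_, hO.cyc (hO.cyc h)⟩
  obtain ⟨A, hA, hyA, hclosed⟩ := hs.exists_of_closes hO _ y hy hcl
  have hsub : nbrs O v ⊆ A := by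
    intro w hw
    obtain ⟨u, hu⟩ := (Finset.mem_filter.1 hw).2
    refine hO.link v A ⟨y, hyA⟩ (fun z hz => ?_) hu
    by_cases hzx : z = x
    · exact ⟨y, hyA, hzx ▸ h⟩
    · exact hclosed z hz hzx
  have h1 := Finset.card_le_card hsub
  have h2 := Finset.card_pos.2 ⟨y, hyA⟩
  change A.card ≤ digit d v - 1 at hA
  omega

end

theorem mem_of_memB {m : ℕ} {l : List ℕ} (h : memB m l = true) : m ∈ l := by
  obtain ⟨x, hx, h⟩ := List.any_eq_true.1 h
  exact Nat.eq_of_beq_eq_true h ▸ hx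

theorem models_of_leafOK {O : ℕ → ℕ → ℕ → Prop} {s : ℕ} (hO : IsRot O) (hs : Agrees O s)
    (hne : ∃ a b c, O a b c) {Ts : List (List ℕ)} {j π : ℕ}
    (h : leafOK (Ts.getD j []) s π = true) : Models Ts O := by
  unfold leafOK at h
  rw [Bool.and_eq_true] at h
  obtain ⟨hπ, h⟩ := h
  have hπ' : ∀ i < 10, digit π i < 10 ∧ ∀ k < i, digit π k ≠ digit π i := by
    intro i hi
    have := List.all_eq_true.1 hπ i (List.mem_range.2 hi)
    rw [Bool.and_eq_true] at this
    refine ⟨Nat.le_of_ble_eq_true this.1, fun k hk he => ?_⟩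
    have := List.all_eq_true.1 this.2 k (List.mem_range.2 hk)
    rw [he, Nat.beq_refl] at this
    exact absurd this (by simp)
  have hmem : ∀ a b c, O a b c → mask (digit π a) (digit π b) (digit π c) ∈ Ts.getD j [] := by
    intro a b c habc
    have := List.all_eq_true.1 h a (List.mem_range.2 (hO.lt habc))
    have := List.all_eq_true.1 this b (List.mem_range.2 (hO.lt₂ habc))
    rw [force_eq] at this
    rcases hs.entry_eq hO habc with he | he <;> rw [he] at this
    · exact absurd this (by simp)
    · have hc := hO.lt₃ habc
      rw [Bool.and_eq_true, Bool.or_eq_true] at this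
      rcases this.2 with h | h
      · have : 10 < c + 1 := Nat.le_of_ble_eq_true h
        omega
      · exact mem_of_memB h
  by_cases hj : j < Ts.length
  · rw [List.getD_eq_getElem _ _ hj] at hmem
    refine ⟨_, List.getElem_mem hj, digit π, fun i hi => (hπ' i hi).1, fun i hi k hk he => ?_, hmem⟩
    rcases lt_trichotomy i k with hik | hik | hik
    · exact absurd he ((hπ' k hk).2 i hik)
    · exact hik
    · exact absurd he.symm ((hπ' i hi).2 k hik)
  · obtain ⟨a, b, c, habc⟩ := hne
    have := hmem a b c habc
    rw [List.getD_eq_default _ _ (not_lt.1 hj)] at this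
    exact absurd this List.not_mem_nil

theorem tryAll_ne_zero {rec : ℕ → ℕ → ℕ} (hrec : ∀ s, rec s 0 = 0) {d s a b : ℕ} (l : List ℕ) :
    ∀ o, tryAll rec d s a b l o ≠ 0 → o ≠ 0 ∧ ∀ c ∈ l, compat s b c a = true →
      compat s c a b = true → linkOK d (place s a b c) a b c = true →
      linkOK d (place s a b c) b c a = true → linkOK d (place s a b c) c a b = true →
      ∃ o', rec (place s a b c) o' ≠ 0 := by
  induction l with
  | nil => exact fun o h => ⟨h, by simp⟩
  | cons x l ih =>
    intro o h
    change (bif compat s b x a && compat s x a b then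
        bif linkOK d (place s a b x) a b x && linkOK d (place s a b x) b x a &&
          linkOK d (place s a b x) x a b
        then tryAll rec d s a b l (rec (place s a b x) o) else tryAll rec d s a b l o
      else tryAll rec d s a b l o) ≠ 0 at h
    by_cases hx : compat s b x a = true ∧ compat s x a b = true ∧
        linkOK d (place s a b x) a b x = true ∧ linkOK d (place s a b x) b x a = true ∧
        linkOK d (place s a b x) x a b = true
    · obtain ⟨h1, h2, h3, h4, h5⟩ := hx
      simp only [h1, h2, h3, h4, h5, Bool.and_self, cond_true] at h
      obtain ⟨h6, h7⟩ := ih _ h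
      refine ⟨fun h0 => h6 (by rw [h0, hrec]), fun c hc => ?_⟩
      rcases List.mem_cons.1 hc with rfl | hc
      · exact fun _ _ _ _ _ => ⟨o, h6⟩
      · exact h7 c hc
    · have h' : tryAll rec d s a b l o ≠ 0 := by
        revert h
        cases h1 : compat s b x a <;> cases h2 : compat s x a b <;>
          cases h3 : linkOK d (place s a b x) a b x <;>
          cases h4 : linkOK d (place s a b x) b x a <;>
          cases h5 : linkOK d (place s a b x) x a b <;>
          simp_all
      obtain ⟨h6, h7⟩ := ih o h'
      refine ⟨h6, fun c hc h1 h2 h3 h4 h5 => ?_⟩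
      rcases List.mem_cons.1 hc with rfl | hc
      · exact absurd ⟨h1, h2, h3, h4, h5⟩ hx
      · exact h7 c hc h1 h2 h3 h4 h5

theorem search_zero (Ts : List (List ℕ)) (d k s : ℕ) : search Ts d k s 0 = 0 := by
  cases k <;> rfl

theorem models_of_search {O : ℕ → ℕ → ℕ → Prop} (hO : IsRot O) (hne : ∃ a b c, O a b c)
    {Ts : List (List ℕ)} {d : ℕ} (hd : ∀ v < 10, digit d v ≤ (nbrs O v).card) (k : ℕ) :
    ∀ s o, Agrees O s → search Ts d k s o ≠ 0 → Models Ts O := by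
  induction k with
  | zero => exact fun s o _ h => absurd rfl h
  | succ k ih =>
    intro s o hs h
    change (bif Nat.beq o 0 then 0 else
      bif Nat.blt (o % 128) 100 then
        bif Nat.beq (entry s (o % 128 / 10) (o % 128 % 10)) 0 then
          tryAll (search Ts d k) d s (o % 128 / 10) (o % 128 % 10)
            [0, 1, 2, 3, 4, 5, 6, 7, 8, 9] (o / 128)
        else 0
      else bif leafOK (Ts.getD (o % 128 - 100) []) s (o / 128 % 2 ^ 42) then
        o / 128 / 2 ^ 42 else 0) ≠ 0 at h
    cases h0 : Nat.beq o 0 with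
    | true => simp [h0] at h
    | false =>
      rw [h0, cond_false] at h
      cases h1 : Nat.blt (o % 128) 100 with
      | true =>
        rw [h1, cond_true] at h
        have hlt : o % 128 < 100 := Nat.le_of_ble_eq_true h1
        have ha : o % 128 / 10 < 10 := by omega
        have hb : o % 128 % 10 < 10 := by omega
        generalize o % 128 / 10 = a at ha h
        generalize o % 128 % 10 = b at hb h
        cases h2 : Nat.beq (entry s a b) 0 with
        | false => rw [h2] at h; exact absurd rfl h
        | true =>
          rw [h2, cond_true] at h
          obtain ⟨c, hc⟩ := (hs a ha b hb).1 (Nat.eq_of_beq_eq_true h2)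
          have hs' := hs.place hO hc
          have hc' := hO.cyc hc
          have hc'' := hO.cyc hc'
          have hlt := hO.lt₃ hc
          obtain ⟨o', ho'⟩ := (tryAll_ne_zero (search_zero Ts d k) _ _ h).2 c
            (by interval_cases c <;> simp) (hs.compat hO hc') (hs.compat hO hc'')
            (hs'.linkOK hO hc (hd a ha)) (hs'.linkOK hO hc' (hd b hb))
            (hs'.linkOK hO hc'' (hd c hlt))
          exact ih _ _ hs' ho'
      | false =>
        rw [h1, cond_false] at h
        refine models_of_leafOK hO hs hne (j := o % 128 - 100) (π := o / 128 % 2 ^ 42) ?_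
        by_contra h2
        rw [Bool.not_eq_true] at h2
        rw [h2] at h
        exact h rfl

/-! ### Renaming the vertices -/

/-- The maps `g` and `h` are mutually inverse permutations of the ten vertices. -/
structure Inverse (g h : ℕ → ℕ) : Prop where
  left_lt : ∀ i < 10, g i < 10
  right_lt : ∀ i < 10, h i < 10
  right_left : ∀ i < 10, h (g i) = i
  left_right : ∀ i < 10, g (h i) = i

/-- The surface with the vertices renamed so that the vertex `i` is the former vertex `h i`. -/
def transport (h : ℕ → ℕ) (O : ℕ → ℕ → ℕ → Prop) (a b c : ℕ) : Prop :=
  a < 10 ∧ b < 10 ∧ c < 10 ∧ O (h a) (h b) (h c)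

/-- The surface with the opposite orientation. -/
def mirror (O : ℕ → ℕ → ℕ → Prop) (a b c : ℕ) : Prop := O b a c

/-- The ordered pairs of distinct vertices that do not form an edge. -/
noncomputable def missing (O : ℕ → ℕ → ℕ → Prop) : Finset (ℕ × ℕ) :=
  (Finset.range 10 ×ˢ Finset.range 10).filter fun e => e.1 ≠ e.2 ∧ ¬ Adj O e.1 e.2

section

variable {O : ℕ → ℕ → ℕ → Prop} {g h : ℕ → ℕ}

theorem mem_missing {a b : ℕ} : (a, b) ∈ missing O ↔ a < 10 ∧ b < 10 ∧ a ≠ b ∧ ¬ Adj O a b := by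
  simp [missing, and_assoc]

theorem IsRot.transport_iff (hO : IsRot O) (hgh : Inverse g h) {a b c : ℕ} :
    transport h O (g a) (g b) (g c) ∧ a < 10 ∧ b < 10 ∧ c < 10 ↔ O a b c := by
  constructor
  · rintro ⟨⟨-, -, -, h1⟩, ha, hb, hc⟩
    rwa [hgh.right_left a ha, hgh.right_left b hb, hgh.right_left c hc] at h1
  · intro h1
    have ha := hO.lt h1
    have hb := hO.lt₂ h1
    have hc := hO.lt₃ h1
    refine ⟨⟨hgh.left_lt a ha, hgh.left_lt b hb, hgh.left_lt c hc, ?_⟩, ha, hb, hc⟩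
    rwa [hgh.right_left a ha, hgh.right_left b hb, hgh.right_left c hc]

theorem IsRot.transport (hO : IsRot O) (hgh : Inverse g h) : IsRot (transport h O) where
  lt := fun h => h.1
  cyc := fun ⟨ha, hb, hc, h⟩ => ⟨hb, hc, ha, hO.cyc h⟩
  ne := fun ⟨_, _, _, h⟩ he => hO.ne h (by rw [he])
  uniq := fun {a b c d} ⟨_, _, hc, h1⟩ ⟨_, _, hd, h2⟩ => by
    rw [← hgh.left_right c hc, ← hgh.left_right d hd, hO.uniq h1 h2]
  opp := fun {a b c} ⟨ha, hb, _, h1⟩ => by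
    obtain ⟨d, hd⟩ := hO.opp h1
    have hd' := hO.lt₃ hd
    exact ⟨g d, hb, ha, hgh.left_lt d hd', by rwa [hgh.right_left d hd']⟩
  link := fun v A hA hcl {x y} ⟨_, hx, _, h1⟩ => by
    have := hO.link (h v) (A.image h) (hA.image h) (fun x hx => by
      obtain ⟨z, hz, rfl⟩ := Finset.mem_image.1 hx
      obtain ⟨w, hw, h2⟩ := hcl z hz
      exact ⟨h w, Finset.mem_image_of_mem h hw, h2.2.2.2⟩) h1
    obtain ⟨z, hz, he⟩ := Finset.mem_image.1 this
    obtain ⟨w, hw, h2⟩ := hcl z hz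
    rwa [← hgh.left_right x hx, ← he, hgh.left_right z h2.2.1]

theorem IsRot.mirror (hO : IsRot O) : IsRot (mirror O) where
  lt := fun h => hO.lt₂ h
  cyc := fun h => hO.cyc (hO.cyc h)
  ne := fun h => (hO.ne h).symm
  uniq := fun h1 h2 => hO.uniq h1 h2
  opp := fun h => hO.opp h
  link := fun v A hA hcl {x y} h1 => by
    choose! f hf using hcl
    have hinj : Set.InjOn f A := fun x hx y hy he => by
      have h2 := hO.cyc (hf x hx).2
      have h3 := hO.cyc (hf y hy).2
      rw [he] at h2
      exact hO.uniq h2 h3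
    have hsurj := Finset.surjOn_of_injOn_of_card_le f (fun x hx => (hf x hx).1) hinj le_rfl
    obtain ⟨d, hd⟩ := hO.opp h1
    refine hO.link v A hA (fun z hz => ?_) hd
    obtain ⟨w, hw, rfl⟩ := hsurj hz
    exact ⟨w, hw, hO.cyc (hf w hw).2⟩

theorem models_of_transport (hO : IsRot O) (hgh : Inverse g h) {Ts : List (List ℕ)}
    (hM : Models Ts (transport h O)) : Models Ts O := by
  obtain ⟨T, hT, σ, h1, h2, h3⟩ := hM
  refine ⟨T, hT, fun i => σ (g i), fun i hi => h1 _ (hgh.left_lt i hi), fun i hi j hj he => ?_,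
    fun a b c habc => h3 _ _ _ ((hO.transport_iff hgh).2 habc).1⟩
  have := h2 _ (hgh.left_lt i hi) _ (hgh.left_lt j hj) he
  rw [← hgh.right_left i hi, this, hgh.right_left j hj]

theorem models_of_mirror {Ts : List (List ℕ)} (hM : Models Ts (mirror O)) : Models Ts O := by
  obtain ⟨T, hT, σ, h1, h2, h3⟩ := hM
  refine ⟨T, hT, σ, h1, h2, fun a b c habc => ?_⟩
  have h4 := h3 b a c habc
  have : mask (σ b) (σ a) (σ c) = mask (σ a) (σ b) (σ c) :=
    congrArg (· ||| 1 <<< σ c) (Nat.or_comm (1 <<< σ b) (1 <<< σ a))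
  rwa [this] at h4

theorem adj_mirror (hO : IsRot O) {a b : ℕ} : Adj (mirror O) a b ↔ Adj O a b :=
  ⟨fun h => hO.adj_symm h, fun h => hO.adj_symm h⟩

theorem missing_mirror (hO : IsRot O) : missing (mirror O) = missing O := by
  unfold missing
  simp only [adj_mirror hO]

theorem adj_transport (hO : IsRot O) (hgh : Inverse g h) {a b : ℕ} (ha : a < 10) (hb : b < 10) :
    Adj (transport h O) (g a) (g b) ↔ Adj O a b := by
  constructor
  · rintro ⟨c, -, -, -, hc⟩
    rw [hgh.right_left a ha, hgh.right_left b hb] at hc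
    exact ⟨_, hc⟩
  · rintro ⟨c, hc⟩
    exact ⟨g c, ((hO.transport_iff hgh).2 hc).1⟩

theorem sum_missing_transport (hO : IsRot O) (hgh : Inverse g h) (f : ℕ × ℕ → ℕ) :
    ∑ e ∈ missing (transport h O), f e = ∑ e ∈ missing O, f (g e.1, g e.2) := by
  symm
  refine Finset.sum_bij' (fun e _ => (g e.1, g e.2)) (fun e _ => (h e.1, h e.2)) ?_ ?_ ?_ ?_ ?_
  · rintro ⟨a, b⟩ he
    obtain ⟨ha, hb, hab, hn⟩ := mem_missing.1 he
    refine mem_missing.2 ⟨hgh.left_lt a ha, hgh.left_lt b hb, fun h1 => hab ?_,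
      mt (adj_transport hO hgh ha hb).1 hn⟩
    rw [← hgh.right_left a ha, h1, hgh.right_left b hb]
  · rintro ⟨a, b⟩ he
    obtain ⟨ha, hb, hab, hn⟩ := mem_missing.1 he
    refine mem_missing.2 ⟨hgh.right_lt a ha, hgh.right_lt b hb, fun h1 => hab ?_, fun h1 => hn ?_⟩
    · rw [← hgh.left_right a ha, h1, hgh.left_right b hb]
    · have := (adj_transport hO hgh (hgh.right_lt a ha) (hgh.right_lt b hb)).2 h1
      rwa [hgh.left_right a ha, hgh.left_right b hb] at this
  · rintro ⟨a, b⟩ he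
    obtain ⟨ha, hb, -, -⟩ := mem_missing.1 he
    simp [hgh.right_left a ha, hgh.right_left b hb]
  · rintro ⟨a, b⟩ he
    obtain ⟨ha, hb, -, -⟩ := mem_missing.1 he
    simp [hgh.left_right a ha, hgh.left_right b hb]
  · rintro ⟨a, b⟩ he
    rfl

end

/-! ### Soundness of the choice of the roots -/

/-- The link of the vertex `0` is `1, …, 9`. -/
def Star (O : ℕ → ℕ → ℕ → Prop) : Prop := ∀ i < 10, 0 < i → O 0 i (nxt i)

/-- The chords that are not edges. -/
noncomputable def missingChords (O : ℕ → ℕ → ℕ → Prop) : List (ℕ × ℕ) :=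
  chords.filter fun e => ¬ Adj O e.1 e.2

set_option synthInstance.maxSize 1000 in
theorem mem_chords_of_ne : ∀ a < 10, ∀ b < 10, a ≠ b → a = 0 ∨ b = 0 ∨ b = nxt a ∨ a = nxt b ∨
    (a, b) ∈ chords ∨ (b, a) ∈ chords := by
  have : ∀ a < 10, ∀ b < 10, a = b ∨ a = 0 ∨ b = 0 ∨ b = nxt a ∨ a = nxt b ∨
      (a, b) ∈ chords ∨ (b, a) ∈ chords := by decide
  exact fun a ha b hb hab => (this a ha b hb).resolve_left hab

theorem chords_lt : ∀ e ∈ chords, e.1 < 10 ∧ e.2 < 10 ∧ e.1 < e.2 := by decide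

theorem chords_nodup : chords.Nodup := by decide

theorem mem_choose {α : Type} : ∀ {xs l : List α} {k : ℕ}, l.Sublist xs → l.length = k →
    l ∈ choose k xs
  | [], l, k, h, hk => by
    obtain rfl := List.sublist_nil.1 h
    obtain rfl : 0 = k := hk
    exact List.mem_singleton.2 rfl
  | x :: xs, l, 0, h, hk => by
    obtain rfl := List.length_eq_zero_iff.1 hk
    exact List.mem_singleton.2 rfl
  | x :: xs, l, k + 1, h, hk => by
    rw [choose, List.mem_append]
    cases h with
    | cons _ h => exact Or.inr (mem_choose h hk)
    | cons_cons _ h =>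
      exact Or.inl (List.mem_map.2 ⟨_, mem_choose h (Nat.succ_injective hk), rfl⟩)

theorem reducible_or_rootOK {Ts : List (List ℕ)} : ∀ {ls : List (List (ℕ × ℕ))} {os : List ℕ},
    rootsOK Ts ls os = true → ∀ l ∈ ls, reducible l = true ∨ ∃ o, rootOK Ts l o = true
  | [], os, _, l, hl => absurd hl List.not_mem_nil
  | l' :: ls, os, h, l, hl => by
    cases h1 : reducible l' with
    | true =>
      have h : (bif reducible l' then rootsOK Ts ls os else _) = true := h
      rw [h1, cond_true] at h
      rcases List.mem_cons.1 hl with rfl | hl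
      · exact Or.inl h1
      · exact reducible_or_rootOK h l hl
    | false =>
      cases os with
      | nil =>
        have h : (bif reducible l' then rootsOK Ts ls [] else false) = true := h
        rw [h1] at h
        exact absurd h (by simp)
      | cons o os =>
        have h : (bif reducible l' then rootsOK Ts ls (o :: os) else
          rootOK Ts l' o && rootsOK Ts ls os) = true := h
        rw [h1, cond_false, Bool.and_eq_true] at h
        rcases List.mem_cons.1 hl with rfl | hl
        · exact Or.inr ⟨o, h.1⟩
        · exact reducible_or_rootOK h.2 l hl

section

variable {O : ℕ → ℕ → ℕ → Prop}

theorem mem_missingChords {e : ℕ × ℕ} :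
    e ∈ missingChords O ↔ e ∈ chords ∧ ¬ Adj O e.1 e.2 := by
  simp [missingChords]

theorem mem_missing_iff (hO : IsRot O) (hst : Star O) {a b : ℕ} :
    (a, b) ∈ missing O ↔ (a, b) ∈ missingChords O ∨ (b, a) ∈ missingChords O := by
  rw [mem_missing, mem_missingChords, mem_missingChords]
  have hsymm : Adj O b a ↔ Adj O a b := ⟨hO.adj_symm, hO.adj_symm⟩
  constructor
  · rintro ⟨ha, hb, hab, hn⟩
    rcases mem_chords_of_ne a ha b hb hab with rfl | rfl | rfl | rfl | h | h
    · exact absurd ⟨_, hst b hb (Nat.pos_of_ne_zero hab.symm)⟩ hn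
    · exact absurd (hO.adj_symm ⟨_, hst a ha (Nat.pos_of_ne_zero hab)⟩) hn
    · rcases Nat.eq_zero_or_pos a with rfl | h0
      · exact absurd ⟨_, hst _ hb (by decide)⟩ hn
      · exact absurd ⟨_, hO.cyc (hst a ha h0)⟩ hn
    · rcases Nat.eq_zero_or_pos b with rfl | h0
      · exact absurd (hO.adj_symm ⟨_, hst _ ha (by decide)⟩) hn
      · exact absurd (hO.adj_symm ⟨_, hO.cyc (hst b hb h0)⟩) hn
    · exact Or.inl ⟨h, hn⟩
    · exact Or.inr ⟨h, mt hsymm.1 hn⟩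
  · rintro (⟨h, hn⟩ | ⟨h, hn⟩) <;> obtain ⟨h1, h2, h3⟩ := chords_lt _ h
    · exact ⟨h1, h2, h3.ne, hn⟩
    · exact ⟨h2, h1, h3.ne', mt hsymm.2 hn⟩

theorem sum_missing (hO : IsRot O) (hst : Star O) (f : ℕ → ℕ → ℕ) :
    ∑ e ∈ missing O, f e.1 e.2 =
      ((missingChords O).map fun e => f e.1 e.2 + f e.2 e.1).sum := by
  have hnd : (missingChords O).Nodup := chords_nodup.filter _
  have heq : missing O =
      (missingChords O).toFinset ∪
        (missingChords O).toFinset.map (Equiv.prodComm ℕ ℕ).toEmbedding := by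
    ext ⟨a, b⟩
    rw [mem_missing_iff hO hst]
    simp
  have hdis : Disjoint (missingChords O).toFinset
      ((missingChords O).toFinset.map (Equiv.prodComm ℕ ℕ).toEmbedding) := by
    rw [Finset.disjoint_left]
    rintro ⟨a, b⟩ h1 h2
    simp only [Finset.mem_map, List.mem_toFinset, Prod.exists] at h1 h2
    obtain ⟨c, d, h2, he⟩ := h2
    simp only [Equiv.coe_toEmbedding, Equiv.prodComm_apply, Prod.swap_prod_mk, Prod.mk.injEq] at he
    obtain ⟨rfl, rfl⟩ := he
    have h3 := (chords_lt _ (mem_missingChords.1 h1).1).2.2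
    have h4 := (chords_lt _ (mem_missingChords.1 h2).1).2.2
    exact absurd h3 (not_lt.2 h4.le)
  rw [heq, Finset.sum_union hdis, Finset.sum_map, ← Finset.sum_add_distrib,
    List.sum_toFinset _ hnd]
  rfl

theorem length_missingChords (hO : IsRot O) (hst : Star O) (h6 : (missing O).card = 6) :
    (missingChords O).length = 3 := by
  have := sum_missing hO hst fun _ _ => 1
  simp [h6] at this
  omega

theorem key_missingChords (hO : IsRot O) (hst : Star O) (g : ℕ → ℕ) :
    key g (missingChords O) = ∑ e ∈ missing O, 2 ^ (10 * g e.1 + g e.2) :=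
  (sum_missing hO hst fun a b => 2 ^ (10 * g a + g b)).symm

/-- All positive information in the table `s` about triangles and non-edges of `O` is true. -/
def Sound (O : ℕ → ℕ → ℕ → Prop) (s : ℕ) : Prop :=
  ∀ a < 10, ∀ b < 10, (∀ c < 10, entry s a b = c + 1 → O a b c) ∧
    (11 ≤ entry s a b → ¬ Adj O a b)

theorem Sound.put (hO : IsRot O) {s : ℕ} (hs : Sound O s) {a b c : ℕ} (h : O a b c) :
    Sound O (put s a b (c + 1)) := by
  intro a' ha' b' hb'
  have hc := hO.lt₃ h
  rw [entry_put s (hO.lt₂ h) (by omega) hb']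
  split_ifs with h'
  · obtain ⟨rfl, rfl⟩ := h'
    obtain ⟨h2, h3⟩ := hs a ha' b hb'
    have : entry s a b ||| (c + 1) = c + 1 := by
      rcases hn : entry s a b with _ | n
      · simp
      · have hn' : n < 10 := by
          by_contra hlt
          exact h3 (by omega) ⟨c, h⟩
        rw [hO.uniq h (h2 n hn' hn), Nat.or_self]
    rw [this]
    refine ⟨fun c' _ hcc => ?_, by omega⟩
    obtain rfl : c = c' := by omega
    exact h
  · exact hs a' ha' b' hb'

theorem Sound.place (hO : IsRot O) {s : ℕ} (hs : Sound O s) {a b c : ℕ} (h : O a b c) :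
    Sound O (place s a b c) :=
  ((hs.put hO h).put hO (hO.cyc h)).put hO (hO.cyc (hO.cyc h))

theorem Sound.put_of_not_adj {s : ℕ} (hs : Sound O s) {a b : ℕ} (hb : b < 10) (h : ¬ Adj O a b) :
    Sound O (TriSearch.put s a b 11) := by
  intro a' ha' b' hb'
  rw [entry_put s hb (by omega) hb']
  split_ifs with h'
  · obtain ⟨rfl, rfl⟩ := h'
    have : 11 ≤ entry s a b ||| 11 := Nat.right_le_or
    exact ⟨fun c hc he => by omega, fun _ => h⟩
  · exact hs a' ha' b' hb'

theorem foldl_induction {α : Type} {P : ℕ → Prop} {f : ℕ → α → ℕ} {l : List α} {s : ℕ} (hs : P s)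
    (hl : ∀ x ∈ l, ∀ s, P s → P (f s x)) : P (l.foldl f s) := by
  induction l generalizing s with
  | nil => exact hs
  | cons x l ih =>
    exact ih (hl x List.mem_cons_self s hs) fun y hy => hl y (List.mem_cons_of_mem x hy)

theorem foldl_induction_of_mem {α : Type} {P : ℕ → Prop} {f : ℕ → α → ℕ} {x : α} {l : List α}
    {s : ℕ} (hx : x ∈ l) (hf : ∀ s, P (f s x)) (hl : ∀ y ∈ l, ∀ s, P s → P (f s y)) :
    P (l.foldl f s) := by
  induction l generalizing s with
  | nil => exact absurd hx List.not_mem_nil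
  | cons y l ih =>
    have hl' : ∀ z ∈ l, ∀ s, P s → P (f s z) := fun z hz => hl z (List.mem_cons_of_mem y hz)
    rcases List.mem_cons.1 hx with rfl | hx
    · exact foldl_induction (s := f s x) (hf s) hl'
    · exact ih hx hl'

theorem entry_put_ne_zero {s a b x a' b' : ℕ} (hb : b < 10) (hx : x < 16) (hb' : b' < 10)
    (h : entry s a' b' ≠ 0) : entry (put s a b x) a' b' ≠ 0 := by
  rw [entry_put s hb hx hb']
  split_ifs with h'
  · obtain ⟨rfl, rfl⟩ := h'
    have : entry s a b ≤ entry s a b ||| x := Nat.left_le_or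
    omega
  · exact h

theorem entry_put_self_ne_zero {s a b x : ℕ} (hb : b < 10) (hx : x < 16) (h : x ≠ 0) :
    entry (put s a b x) a b ≠ 0 := by
  rw [entry_put s hb hx hb, if_pos ⟨rfl, rfl⟩]
  have : x ≤ entry s a b ||| x := Nat.right_le_or
  omega

theorem agrees_initial (hO : IsRot O) (hst : Star O) : Agrees O (initial (missingChords O)) := by
  have hlt : ∀ e ∈ missingChords O, e.1 < 10 ∧ e.2 < 10 := fun e he =>
    have := chords_lt e (mem_missingChords.1 he).1
    ⟨this.1, this.2.1⟩
  have hsound : Sound O (initial (missingChords O)) := by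
    refine foldl_induction (foldl_induction (foldl_induction ?_ ?_) ?_) ?_
    · intro a _ b _
      have : entry 0 a b = 0 := by simp [entry]
      rw [this]
      exact ⟨fun c _ h => by omega, fun h => by omega⟩
    · exact fun v hv s hs => hs.put_of_not_adj (List.mem_range.1 hv) fun ⟨c, hc⟩ => hO.ne hc rfl
    · exact fun i hi s hs => hs.place hO (hst (i + 1) (by have := List.mem_range.1 hi; omega)
        (Nat.succ_pos i))
    · intro e he s hs
      have hn := (mem_missingChords.1 he).2
      exact (hs.put_of_not_adj (hlt e he).2 hn).put_of_not_adj (hlt e he).1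
        fun h => hn (hO.adj_symm h)
  refine fun a ha b hb => ⟨fun h0 => ?_, hsound a ha b hb⟩
  by_contra hn
  revert h0
  change entry (initial (missingChords O)) a b ≠ 0
  have hstep : ∀ e ∈ missingChords O, ∀ s, entry s a b ≠ 0 →
      entry (put (put s e.1 e.2 11) e.2 e.1 11) a b ≠ 0 := fun e he s hs =>
    entry_put_ne_zero (hlt e he).1 (by norm_num) hb
      (entry_put_ne_zero (hlt e he).2 (by norm_num) hb hs)
  by_cases hab : a = b
  · subst hab
    refine foldl_induction ?_ hstep
    have : ∀ v < 10, entry ((List.range 9).foldl (fun s i => place s 0 (i + 1) (nxt (i + 1)))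
      ((List.range 10).foldl (fun s v => put s v v 11) 0)) v v ≠ 0 := by decide
    exact this a ha
  · rcases (mem_missing_iff hO hst).1 (mem_missing.2 ⟨ha, hb, hab, hn⟩) with h | h
    · exact foldl_induction_of_mem h (fun s => entry_put_ne_zero ha (by norm_num) hb
        (entry_put_self_ne_zero hb (by norm_num) (by norm_num))) hstep
    · exact foldl_induction_of_mem h
        (fun s => entry_put_self_ne_zero hb (by norm_num) (by norm_num)) hstep

theorem models_of_rootOK (hO : IsRot O) (hst : Star O) {Ts : List (List ℕ)} {o : ℕ}
    (h : rootOK Ts (missingChords O) o = true) : Models Ts O := by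
  change (degreesOK (degrees (missingChords O)) (initial (missingChords O)) &&
    Nat.blt 0 (search Ts (degrees (missingChords O)) 25 (initial (missingChords O)) o)) = true at h
  rw [Bool.and_eq_true] at h
  have hs := agrees_initial hO hst
  have hd : ∀ v < 10, digit (degrees (missingChords O)) v ≤ (nbrs O v).card := by
    intro v hv
    refine (Nat.le_of_ble_eq_true (List.all_eq_true.1 h.1 v (List.mem_range.2 hv))).trans ?_
    rw [List.countP_eq_length_filter, ← List.toFinset_card_of_nodup (List.nodup_range.filter _)]
    refine Finset.card_le_card fun w hw => ?_
    rw [List.mem_toFinset, List.mem_filter, List.mem_range] at hw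
    refine Finset.mem_filter.2 ⟨Finset.mem_range.2 hw.1, ?_⟩
    have hlt : entry (initial (missingChords O)) v w < 11 := Nat.le_of_ble_eq_true hw.2
    obtain ⟨h1, h2, -⟩ := hs v hv w hw.1
    rcases he : entry (initial (missingChords O)) v w with _ | n
    · exact h1 he
    · exact ⟨n, h2 n (by omega) he⟩
  have hpos : 0 < search Ts (degrees (missingChords O)) 25 (initial (missingChords O)) o :=
    Nat.le_of_ble_eq_true h.2
  exact models_of_search hO ⟨0, 1, _, hst 1 (by norm_num) (by norm_num)⟩ hd 25 _ o hs hpos.ne'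

end

theorem inverse_rot {r : ℕ} (hr : r < 9) : Inverse (rot r) (rot (9 - r)) where
  left_lt := by revert r; decide
  right_lt := by revert r; decide
  right_left := by revert r; decide
  left_right := by revert r; decide

theorem inverse_reflect {r : ℕ} (hr : r < 9) : Inverse (reflect r) (reflect r) where
  left_lt := by revert r; decide
  right_lt := by revert r; decide
  right_left := by revert r; decide
  left_right := by revert r; decide

theorem Star.transport_rot {O : ℕ → ℕ → ℕ → Prop} (hst : Star O) {r : ℕ} (hr : r < 9) :
    Star (transport (rot (9 - r)) O) := by
  intro i hi h0
  have key : ∀ r < 9, ∀ i < 10, 0 < i → nxt i < 10 ∧ rot (9 - r) i < 10 ∧ 0 < rot (9 - r) i ∧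
      rot (9 - r) 0 = 0 ∧ rot (9 - r) (nxt i) = nxt (rot (9 - r) i) := by decide
  obtain ⟨h1, h2, h3, h4, h5⟩ := key r hr i hi h0
  refine ⟨by norm_num, hi, h1, ?_⟩
  rw [h4, h5]
  exact hst _ h2 h3

theorem Star.mirror_transport_reflect {O : ℕ → ℕ → ℕ → Prop} (hO : IsRot O) (hst : Star O) {r : ℕ}
    (hr : r < 9) : Star (mirror (transport (reflect r) O)) := by
  intro i hi h0
  have key : ∀ r < 9, ∀ i < 10, 0 < i → nxt i < 10 ∧ reflect r (nxt i) < 10 ∧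
      0 < reflect r (nxt i) ∧ reflect r 0 = 0 ∧ nxt (reflect r (nxt i)) = reflect r i := by decide
  obtain ⟨h1, h2, h3, h4, h5⟩ := key r hr i hi h0
  refine ⟨hi, by norm_num, h1, ?_⟩
  rw [h4]
  have := hst _ h2 h3
  rw [h5] at this
  exact hO.cyc (hO.cyc this)

theorem models_of_star {Ts : List (List ℕ)} {os : List ℕ}
    (hroots : rootsOK Ts (choose 3 chords) os = true) {O : ℕ → ℕ → ℕ → Prop} (hO : IsRot O)
    (hst : Star O) (h6 : (missing O).card = 6) : Models Ts O := by
  induction hn : ∑ e ∈ missing O, 2 ^ (10 * e.1 + e.2) using Nat.strong_induction_on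
    generalizing O with
  | _ n ih =>
    rcases reducible_or_rootOK hroots _ (mem_choose (List.filter_sublist)
      (length_missingChords hO hst h6)) with h | ⟨o, h⟩
    · change ((List.range 9).any fun r =>
        Nat.blt (key (rot r) (missingChords O)) (key id (missingChords O)) ||
        Nat.blt (key (reflect r) (missingChords O)) (key id (missingChords O))) = true at h
      obtain ⟨r, hr, h⟩ := List.any_eq_true.1 h
      rw [List.mem_range] at hr
      rw [Bool.or_eq_true] at h
      simp only [key_missingChords hO hst, id, hn] at h
      have hcard : ∀ {g h}, Inverse g h → (missing (transport h O)).card = 6 := fun hgh => by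
        rw [← h6, Finset.card_eq_sum_ones, sum_missing_transport hO hgh, Finset.card_eq_sum_ones]
      rcases h with h | h
      · have hgh := inverse_rot hr
        refine models_of_transport hO hgh (ih _ ?_ (hO.transport hgh) (hst.transport_rot hr)
          (hcard hgh) rfl)
        rw [sum_missing_transport hO hgh]
        exact Nat.le_of_ble_eq_true h
      · have hgh := inverse_reflect hr
        have hO' := hO.transport hgh
        refine models_of_transport hO hgh (models_of_mirror (ih _ ?_ hO'.mirror
          (hst.mirror_transport_reflect hO hr) ?_ rfl))
        · rw [missing_mirror hO', sum_missing_transport hO hgh]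
          exact Nat.le_of_ble_eq_true h
        · rw [missing_mirror hO']
          exact hcard hgh
    · exact models_of_rootOK hO hst h

/-! ### Realizations and separating planes -/

/-- The point `x` is the combination of the points `p v` with nonnegative weights `w v` of total
weight one that vanish outside `σ`. -/
structure IsWeight {n : ℕ} (p : Fin n → Fin 3 → ℝ) (σ : Finset (Fin n)) (x : Fin 3 → ℝ)
    (w : Fin n → ℝ) : Prop where
  nonneg : ∀ v, 0 ≤ w v
  eq_zero : ∀ v, v ∉ σ → w v = 0
  sum_eq : ∑ v, w v = 1
  sum_smul : ∑ v, w v • p v = x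

section

variable {n : ℕ} {p : Fin n → Fin 3 → ℝ} {σ τ : Finset (Fin n)}

theorem exists_isWeight {x : Fin 3 → ℝ} (hx : x ∈ convexHull ℝ (p '' ↑σ)) :
    ∃ w, IsWeight p σ x w := by
  revert x
  change convexHull ℝ (p '' ↑σ) ⊆ {x | ∃ w, IsWeight p σ x w}
  refine convexHull_min ?_ ?_
  · rintro _ ⟨v, hv, rfl⟩
    refine ⟨fun u => if u = v then 1 else 0, fun u => ?_, fun u hu => ?_, ?_, ?_⟩
    · split_ifs <;> norm_num
    · exact if_neg (by rintro rfl; exact hu hv)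
    · simp
    · simp
  · rintro x ⟨w, hw⟩ y ⟨u, hu⟩ a b ha hb hab
    refine ⟨fun v => a * w v + b * u v, fun v => ?_, fun v hv => ?_, ?_, ?_⟩
    · have := hw.nonneg v
      have := hu.nonneg v
      positivity
    · simp [hw.eq_zero v hv, hu.eq_zero v hv]
    · rw [Finset.sum_add_distrib, ← Finset.mul_sum, ← Finset.mul_sum, hw.sum_eq, hu.sum_eq]
      simpa using hab
    · simp only [add_smul, mul_smul]
      rw [Finset.sum_add_distrib, ← Finset.smul_sum, ← Finset.smul_sum, hw.sum_smul, hu.sum_smul]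

theorem IsWeight.mem_convexHull {x : Fin 3 → ℝ} {w : Fin n → ℝ} (hw : IsWeight p σ x w) :
    x ∈ convexHull ℝ (p '' ↑σ) := by
  have h1 : ∑ v ∈ σ, w v = 1 := by
    rw [← hw.sum_eq]
    exact Finset.sum_subset (Finset.subset_univ σ) fun v _ hv => hw.eq_zero v hv
  have h2 : ∑ v ∈ σ, w v • p v = x := by
    rw [← hw.sum_smul]
    exact Finset.sum_subset (Finset.subset_univ σ) fun v _ hv => by rw [hw.eq_zero v hv, zero_smul]
  rw [← h2]
  exact (convex_convexHull ℝ _).sum_mem (fun v _ => hw.nonneg v) h1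
    fun v hv => subset_convexHull ℝ _ (Set.mem_image_of_mem p hv)

theorem sum_mul_sub (f : (Fin 3 → ℝ) →ₗ[ℝ] ℝ) (d : ℝ) (w : Fin n → ℝ) :
    ∑ v, w v * (f (p v) - d) = f (∑ v, w v • p v) - (∑ v, w v) * d := by
  simp [map_sum, mul_sub, Finset.sum_sub_distrib, Finset.sum_mul]

/-- Some plane separates the points of `F` from those of `G` and meets both sets exactly in the
common points. -/
def Separated (p : Fin n → Fin 3 → ℝ) (F G : Finset (Fin n)) : Prop :=
  ∃ (f : (Fin 3 → ℝ) →ₗ[ℝ] ℝ) (d : ℝ), (∀ v ∈ F, v ∈ G → f (p v) = d) ∧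
    (∀ v ∈ F, v ∉ G → d < f (p v)) ∧ ∀ v ∈ G, v ∉ F → f (p v) < d

theorem Separated.symm {F G : Finset (Fin n)} (h : Separated p F G) : Separated p G F := by
  obtain ⟨f, d, h1, h2, h3⟩ := h
  refine ⟨-f, -d, fun v hG hF => ?_, fun v hG hF => ?_, fun v hF hG => ?_⟩
  · simp [h1 v hF hG]
  · simpa using h3 v hG hF
  · simpa using h2 v hF hG

theorem exists_adjacent (S : TriSurface n) {F : Finset (Fin n)} (hF : F ∈ S.faces) {a : Fin n}
    (ha : a ∈ F) : ∃ G ∈ S.faces, G ≠ F ∧ a ∉ G ∧ ∀ v ∈ F, v ≠ a → v ∈ G := by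
  have h3 := S.card_eq F hF
  have h2 : (F.erase a).card = 2 := by rw [Finset.card_erase_of_mem ha, h3]
  obtain ⟨b, c, hbc, he⟩ := Finset.card_eq_two.1 h2
  have hb : b ∈ F := Finset.mem_of_mem_erase (he ▸ Finset.mem_insert_self b {c})
  have hc : c ∈ F := Finset.mem_of_mem_erase (he ▸ by simp : c ∈ F.erase a)
  have hcard := S.edge_two b c hbc ⟨F, hF, hb, hc⟩
  obtain ⟨G, hG, hGF⟩ := Finset.exists_mem_ne (by rw [hcard]; norm_num) F
  obtain ⟨hG, hbG, hcG⟩ := Finset.mem_filter.1 hG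
  have hsub : ∀ v ∈ F, v ≠ a → v ∈ G := fun v hv hva => by
    have : v ∈ F.erase a := Finset.mem_erase.2 ⟨hva, hv⟩
    rw [he, Finset.mem_insert, Finset.mem_singleton] at this
    rcases this with rfl | rfl <;> assumption
  refine ⟨G, hG, hGF, fun haG => hGF ?_, hsub⟩
  refine (Finset.eq_of_subset_of_card_le (fun v hv => ?_) ?_).symm
  · by_cases hva : v = a
    · exact hva ▸ haG
    · exact hsub v hv hva
  · rw [h3, S.card_eq G hG]

theorem isRealization_of_separated (S : TriSurface n)
    (hsep : ∀ F ∈ S.faces, ∀ G ∈ S.faces, F ≠ G → Separated p F G) : S.IsRealization p := by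
  have hind : ∀ F ∈ S.faces, ∀ w : Fin n → ℝ, (∀ v, v ∉ F → w v = 0) → ∑ v, w v = 0 →
      ∑ v, w v • p v = 0 → ∀ v, w v = 0 := by
    intro F hF w hw h0 h1 a
    by_cases ha : a ∈ F
    · obtain ⟨G, hG, hGF, haG, hsub⟩ := exists_adjacent S hF ha
      obtain ⟨f, d, hd, hpos, -⟩ := hsep F hF G hG hGF.symm
      have hsum := sum_mul_sub (p := p) f d w
      rw [h0, h1, map_zero, zero_mul, sub_zero, Finset.sum_eq_single a] at hsum
      · exact (mul_eq_zero.1 hsum).resolve_right (sub_pos.2 (hpos a ha haG)).ne'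
      · intro v _ hva
        by_cases hv : v ∈ F
        · rw [hd v hv (hsub v hv hva), sub_self, mul_zero]
        · rw [hw v hv, zero_mul]
      · simp
    · exact hw a ha
  refine ⟨fun F hF => ?_, fun σ τ hσ hτ => ?_⟩
  · rw [affineIndependent_iff]
    intro s w h0 h1 e he
    set w' : Fin n → ℝ := fun v => if h : v ∈ F then (if ⟨v, h⟩ ∈ s then w ⟨v, h⟩ else 0) else 0
      with hw'
    have hout : ∀ v, v ∉ F → w' v = 0 := fun v hv => dif_neg hv
    have hin : ∀ x : {x // x ∈ F}, w' x = if x ∈ s then w x else 0 := fun x => dif_pos x.2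
    have hs : F.attach ∩ s = s := Finset.inter_eq_right.2 fun x _ => Finset.mem_attach F x
    have h := hind F hF w' hout ?_ ?_ e
    · rw [hin, if_pos he] at h
      exact h
    · rw [← Finset.sum_subset (Finset.subset_univ F) fun v _ hv => hout v hv,
        ← Finset.sum_coe_sort F]
      simpa [hin, hs] using h0
    · rw [← Finset.sum_subset (Finset.subset_univ F) fun v _ hv => by rw [hout v hv, zero_smul],
        ← Finset.sum_coe_sort F]
      simpa [hin, ite_smul, hs] using h1
  · obtain ⟨-, F, hF, hσF⟩ := hσ
    obtain ⟨-, G, hG, hτG⟩ := hτ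
    refine Set.Subset.antisymm ?_ (Set.subset_inter ?_ ?_)
    · rintro x ⟨hxσ, hxτ⟩
      obtain ⟨w, hw⟩ := exists_isWeight hxσ
      obtain ⟨u, hu⟩ := exists_isWeight hxτ
      have huF : ∀ v, v ∉ F → u v = 0 := by
        intro v hvF
        by_cases hFG : F = G
        · exact hu.eq_zero v fun h => hvF (hFG ▸ hτG h)
        by_cases hvG : v ∈ G
        swap
        · exact hu.eq_zero v fun h => hvG (hτG h)
        obtain ⟨f, d, hd, hpos, hneg⟩ := hsep F hF G hG hFG
        have hsw := sum_mul_sub (p := p) f d w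
        have hsu := sum_mul_sub (p := p) f d u
        rw [hw.sum_eq, hw.sum_smul] at hsw
        rw [hu.sum_eq, hu.sum_smul] at hsu
        have hwt : ∀ v, 0 ≤ w v * (f (p v) - d) := fun v => by
          by_cases hv : v ∈ F
          · refine mul_nonneg (hw.nonneg v) (sub_nonneg.2 ?_)
            by_cases hv' : v ∈ G
            · exact (hd v hv hv').ge
            · exact (hpos v hv hv').le
          · rw [hw.eq_zero v fun h => hv (hσF h), zero_mul]
        have hut : ∀ v, u v * (f (p v) - d) ≤ 0 := fun v => by
          by_cases hv : v ∈ G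
          · refine mul_nonpos_of_nonneg_of_nonpos (hu.nonneg v) (sub_nonpos.2 ?_)
            by_cases hv' : v ∈ F
            · exact (hd v hv' hv).le
            · exact (hneg v hv hv').le
          · rw [hu.eq_zero v fun h => hv (hτG h), zero_mul]
        have h0 : 0 ≤ ∑ v, u v * (f (p v) - d) := by
          rw [hsu, ← hsw]
          exact Finset.sum_nonneg fun v _ => hwt v
        have h1 := (Finset.sum_eq_zero_iff_of_nonpos fun v _ => hut v).1
          (le_antisymm (Finset.sum_nonpos fun v _ => hut v) h0) v (Finset.mem_univ v)
        exact (mul_eq_zero.1 h1).resolve_right (sub_neg.2 (hneg v hvG hvF)).ne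
      have hwu : ∀ v, w v - u v = 0 := hind F hF (fun v => w v - u v)
        (fun v hv => by rw [hw.eq_zero v fun h => hv (hσF h), huF v hv, sub_zero])
        (by rw [Finset.sum_sub_distrib, hw.sum_eq, hu.sum_eq, sub_self])
        (by simp only [sub_smul]; rw [Finset.sum_sub_distrib, hw.sum_smul, hu.sum_smul, sub_self])
      refine IsWeight.mem_convexHull (w := w) ⟨hw.nonneg, fun v hv => ?_, hw.sum_eq, hw.sum_smul⟩
      by_cases hvσ : v ∈ σ
      · rw [sub_eq_zero.1 (hwu v)]
        exact hu.eq_zero v fun h => hv (Finset.mem_inter.2 ⟨hvσ, h⟩)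
      · exact hw.eq_zero v hvσ
    · exact convexHull_mono (Set.image_mono (Finset.coe_subset.2 Finset.inter_subset_left))
    · exact convexHull_mono (Set.image_mono (Finset.coe_subset.2 Finset.inter_subset_right))

end

/-! ### Soundness of the check of the templates -/

theorem testBit_mask (x y z i : ℕ) : (mask x y z).testBit i = true ↔ i = x ∨ i = y ∨ i = z := by
  change ((1 <<< x ||| 1 <<< y) ||| 1 <<< z).testBit i = true ↔ _
  simp only [Nat.one_shiftLeft, Nat.testBit_or, Nat.testBit_two_pow, Bool.or_eq_true,
    decide_eq_true_eq]
  omega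

/-- The position of the point with index `v` of `T`. -/
noncomputable def Template.point (T : Template) (v : ℕ) (i : Fin 3) : ℝ := T.coord v i

theorem testBit_of_land_eq {q m i : ℕ} (h : Nat.beq (Nat.land q m) m = true)
    (hi : m.testBit i = true) : q.testBit i = true := by
  have h' : q &&& m = m := Nat.eq_of_beq_eq_true h
  rw [← h', Nat.testBit_and, Bool.and_eq_true] at hi
  exact hi.1

/-- The points of `T` whose indices are in the mask `F` are separated from those whose indices are
in the mask `G`. -/
def Template.Separates (T : Template) (F G : ℕ) : Prop :=
  ∃ (f : (Fin 3 → ℝ) →ₗ[ℝ] ℝ) (d : ℝ), ∀ v < 10,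
    (F.testBit v = true → G.testBit v = true → f (T.point v) = d) ∧
    (F.testBit v = true → G.testBit v = false → d < f (T.point v)) ∧
    (G.testBit v = true → F.testBit v = false → f (T.point v) < d)

theorem Template.Separates.symm {T : Template} {F G : ℕ} (h : T.Separates F G) :
    T.Separates G F := by
  obtain ⟨f, d, h⟩ := h
  refine ⟨-f, -d, fun v hv => ?_⟩
  obtain ⟨h1, h2, h3⟩ := h v hv
  refine ⟨fun hG hF => ?_, fun hG hF => ?_, fun hF hG => ?_⟩
  · simp [h1 hF hG]
  · simpa using h3 hG hF
  · simpa using h2 hF hG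

theorem Template.separates_of_land_eq {T : Template} {q F G : ℕ} (hq : T.planeOK q = true)
    (h : Nat.beq (Nat.land q (sepMask F G)) (sepMask F G) = true) : T.Separates F G := by
  refine ⟨((q / 2 ^ 30 % 1024 : ℕ) - 512 : ℝ) • LinearMap.proj 0 +
    ((q / 2 ^ 40 % 1024 : ℕ) - 512 : ℝ) • LinearMap.proj 1 +
    ((q / 2 ^ 50 % 1024 : ℕ) - 512 : ℝ) • LinearMap.proj 2, (q / 2 ^ 60 : ℕ) - 131072,
    fun v hv => ?_⟩
  have hside : sideOK q v (T.coord v 0) (T.coord v 1) (T.coord v 2) = true :=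
    List.all_eq_true.1 hq v (List.mem_range.2 hv)
  simp only [sideOK, Bool.and_eq_true, Bool.or_eq_true, Bool.not_eq_true'] at hside
  obtain ⟨⟨hP, hN⟩, hZ⟩ := hside
  simp only [LinearMap.add_apply, LinearMap.smul_apply, LinearMap.proj_apply, smul_eq_mul,
    Template.point, Fin.val_zero, Fin.val_one, Fin.val_two]
  generalize q / 2 ^ 30 % 1024 = a at *
  generalize q / 2 ^ 40 % 1024 = b at *
  generalize q / 2 ^ 50 % 1024 = c at *
  generalize q / 2 ^ 60 = d at *
  generalize T.coord v 0 = x at *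
  generalize T.coord v 1 = y at *
  generalize T.coord v 2 = z at *
  have bit : ∀ {i}, (sepMask F G).testBit i = true → q.testBit i = true :=
    fun hi => testBit_of_land_eq h hi
  refine ⟨fun hF hG => ?_, fun hF hG => ?_, fun hG hF => ?_⟩
  · have h1 := bit (i := 20 + v) (by simp [sepMask, hF, hG])
    rw [h1] at hZ
    have h2 : a * x + b * y + c * z + 131072 = d + 512 * (x + y + z) :=
      Nat.eq_of_beq_eq_true (hZ.resolve_left (by simp))
    have h3 : (a * x + b * y + c * z + 131072 : ℝ) = d + 512 * (x + y + z) := by exact_mod_cast h2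
    linarith
  · have h1 := bit (i := v) (by simp [sepMask, hF, hG])
    rw [h1] at hP
    have h2 : d + 512 * (x + y + z) < a * x + b * y + c * z + 131072 :=
      Nat.le_of_ble_eq_true (hP.resolve_left (by simp))
    have h3 : (d + 512 * (x + y + z) : ℝ) < a * x + b * y + c * z + 131072 := by exact_mod_cast h2
    linarith
  · have h1 := bit (i := 10 + v) (by simp [sepMask, hF, hG])
    rw [h1] at hN
    have h2 : a * x + b * y + c * z + 131072 < d + 512 * (x + y + z) :=
      Nat.le_of_ble_eq_true (hN.resolve_left (by simp))
    have h3 : (a * x + b * y + c * z + 131072 : ℝ) < d + 512 * (x + y + z) := by exact_mod_cast h2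
    linarith

theorem Template.separates_of_pairOK {T : Template} (hT : T.planes.all T.planeOK = true) {F G : ℕ}
    (h : T.pairOK F G = true) : T.Separates F G := by
  obtain ⟨q, hq, h⟩ := List.any_eq_true.1
    (show covers T.planes (sepMask F G) (sepMask G F) = true from h)
  have hq' := List.all_eq_true.1 hT q hq
  rw [Bool.or_eq_true] at h
  rcases h with h | h
  · exact separates_of_land_eq hq' h
  · exact (separates_of_land_eq hq' h).symm

theorem Template.pairOK_of_pairsOK {T : Template} {l : List ℕ} (h : T.pairsOK l = true) {F G : ℕ}
    (hF : F ∈ l) (hG : G ∈ l) (hFG : F ≠ G) : T.pairOK F G = true ∨ T.pairOK G F = true := by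
  induction l with
  | nil => exact absurd hF List.not_mem_nil
  | cons x l ih =>
    have h : (l.all (T.pairOK x) && T.pairsOK l) = true := h
    rw [Bool.and_eq_true, List.all_eq_true] at h
    rcases List.mem_cons.1 hF with rfl | hF' <;> rcases List.mem_cons.1 hG with rfl | hG'
    · exact absurd rfl hFG
    · exact Or.inl (h.1 G hG')
    · exact Or.inr (h.1 F hF')
    · exact ih h.2 hF' hG'

theorem Template.separates_of_ok {T : Template} (h : T.ok = true) {F G : ℕ} (hF : F ∈ T.tris)
    (hG : G ∈ T.tris) (hFG : F ≠ G) : T.Separates F G := by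
  rw [Template.ok, Bool.and_eq_true] at h
  rcases pairOK_of_pairsOK h.2 hF hG hFG with h' | h'
  · exact separates_of_pairOK h.1 h'
  · exact (separates_of_pairOK h.1 h').symm

theorem isRealization_of_template (S : TriSurface 10) {T : Template} (hT : T.ok = true) {σ : ℕ → ℕ}
    (hσ : ∀ i < 10, σ i < 10) (hinj : ∀ i < 10, ∀ j < 10, σ i = σ j → i = j)
    (hS : ∀ F ∈ S.faces, ∃ a b c : Fin 10, F = {a, b, c} ∧ mask (σ a) (σ b) (σ c) ∈ T.tris) :
    S.IsRealization fun v => T.point (σ v) := by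
  choose! a b c hS' using hS
  have hbit : ∀ F ∈ S.faces, ∀ v : Fin 10,
      (mask (σ (a F)) (σ (b F)) (σ (c F))).testBit (σ v) = true ↔ v ∈ F := by
    intro F hF v
    have hσv : ∀ u : Fin 10, σ v = σ u ↔ v = u := fun u =>
      ⟨fun h => Fin.ext (hinj v v.2 u u.2 h), fun h => by rw [h]⟩
    rw [testBit_mask, hσv, hσv, hσv]
    conv_rhs => rw [(hS' F hF).1]
    simp
  refine isRealization_of_separated S fun F hF G hG hFG => ?_
  have hne : mask (σ (a F)) (σ (b F)) (σ (c F)) ≠ mask (σ (a G)) (σ (b G)) (σ (c G)) := by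
    intro he
    refine hFG (Finset.ext fun v => ?_)
    rw [← hbit F hF, ← hbit G hG, he]
  obtain ⟨f, d, h⟩ := Template.separates_of_ok hT (hS' F hF).2 (hS' G hG).2 hne
  have hbit' : ∀ F ∈ S.faces, ∀ v : Fin 10, v ∉ F →
      (mask (σ (a F)) (σ (b F)) (σ (c F))).testBit (σ v) = false := fun F hF v hv => by
    rw [← Bool.not_eq_true, hbit F hF]
    exact hv
  refine ⟨f, d, fun v hvF hvG => ?_, fun v hvF hvG => ?_, fun v hvG hvF => ?_⟩
  · exact (h (σ v) (hσ v v.2)).1 ((hbit F hF v).2 hvF) ((hbit G hG v).2 hvG)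
  · exact (h (σ v) (hσ v v.2)).2.1 ((hbit F hF v).2 hvF) (hbit' G hG v hvG)
  · exact (h (σ v) (hσ v v.2)).2.2 ((hbit G hG v).2 hvG) (hbit' F hF v hvF)

/-! ### Vertices of full degree -/

theorem exists_inverse {h : ℕ → ℕ} (hlt : ∀ i < 10, h i < 10)
    (hinj : ∀ i < 10, ∀ j < 10, h i = h j → i = j) : ∃ g, Inverse g h := by
  have hsurj : ∀ j < 10, ∃ i < 10, h i = j := fun j hj => by
    obtain ⟨i, hi, hij⟩ := Finset.surjOn_of_injOn_of_card_le (s := Finset.range 10)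
      (t := Finset.range 10) h (fun i hi => by simpa using hlt i (by simpa using hi))
      (fun i hi j hj => hinj i (by simpa using hi) j (by simpa using hj)) le_rfl
      (show j ∈ (Finset.range 10 : Set ℕ) by simpa using hj)
    exact ⟨i, by simpa using hi, hij⟩
  choose! g hg using hsurj
  exact ⟨g, fun i hi => (hg i hi).1, hlt, fun i hi => (hg i hi).2, fun i hi =>
    hinj _ (hg _ (hlt i hi)).1 i hi (hg _ (hlt i hi)).2⟩

section

variable {O : ℕ → ℕ → ℕ → Prop}

theorem exists_full (h6 : (missing O).card = 6) : ∃ v < 10, ∀ x < 10, x ≠ v → Adj O v x := by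
  have hcard : ((missing O).image Prod.fst).card < (Finset.range 10).card :=
    Finset.card_image_le.trans_lt (by simp [h6])
  obtain ⟨v, hv, hv'⟩ := Finset.exists_mem_notMem_of_card_lt_card hcard
  refine ⟨v, by simpa using hv, fun x hx hxv => ?_⟩
  by_contra hn
  exact hv' (Finset.mem_image.2 ⟨(v, x), mem_missing.2 ⟨by simpa using hv, hx, hxv.symm, hn⟩, rfl⟩)

theorem exists_star (hO : IsRot O) (h6 : (missing O).card = 6) :
    ∃ g h, Inverse g h ∧ Star (transport h O) := by
  obtain ⟨v, hv, hfull⟩ := exists_full h6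
  choose! s hs using hfull
  obtain ⟨w, hw, hwv⟩ : ∃ w < 10, w ≠ v := by
    by_cases h : v = 0
    · exact ⟨1, by simp, by simp [h]⟩
    · exact ⟨0, by simp, Ne.symm h⟩
  have hiter : ∀ i, s^[i] w < 10 ∧ s^[i] w ≠ v := by
    intro i
    induction i with
    | zero => exact ⟨hw, hwv⟩
    | succ i ih =>
      rw [Function.iterate_succ_apply']
      have := hs _ ih.1 ih.2
      exact ⟨hO.lt₃ this, hO.ne (hO.cyc (hO.cyc this))⟩
  have hO' : ∀ i, O v (s^[i] w) (s^[i + 1] w) := fun i => by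
    rw [Function.iterate_succ_apply']
    exact hs _ (hiter i).1 (hiter i).2
  have hcancel : ∀ i k, s^[i + k] w = s^[i] w → s^[k] w = w := by
    intro i k
    induction i with
    | zero => intro h; simpa using h
    | succ i ih =>
      intro h
      have h1 := hO' (i + k)
      rw [show i + k + 1 = i + 1 + k by omega, h] at h1
      exact ih (hO.uniq (hO.cyc (hO.cyc h1)) (hO.cyc (hO.cyc (hO' i))))
  have horbit : ∀ k, 0 < k → s^[k] w = w →
      (Finset.range 10).erase v ⊆ (Finset.range k).image fun i => s^[i] w := by
    intro k hk hkw x hx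
    rw [Finset.mem_erase, Finset.mem_range] at hx
    refine hO.link v _ ⟨w, Finset.mem_image.2 ⟨0, by simpa using hk, rfl⟩⟩ (fun y hy => ?_)
      (hs x hx.2 hx.1)
    obtain ⟨i, hi, rfl⟩ := Finset.mem_image.1 hy
    refine ⟨s^[i + 1] w, Finset.mem_image.2 ?_, hO' i⟩
    rcases Nat.lt_or_ge (i + 1) k with h | h
    · exact ⟨i + 1, by simpa using h, rfl⟩
    · have : i + 1 = k := by have := Finset.mem_range.1 hi; omega
      exact ⟨0, by simpa using hk, by rw [this, hkw]; rfl⟩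
  have hX : ((Finset.range 10).erase v).card = 9 := by
    rw [Finset.card_erase_of_mem (by simpa using hv)]; simp
  have hper : ∀ k, 0 < k → s^[k] w = w → 9 ≤ k := fun k hk hkw => by
    have := (Finset.card_le_card (horbit k hk hkw)).trans Finset.card_image_le
    rwa [hX, Finset.card_range] at this
  have hinj : ∀ i < 9, ∀ j < 9, s^[i] w = s^[j] w → i = j := by
    have aux : ∀ i < 9, ∀ j < 9, s^[i] w = s^[j] w → ¬ i < j := by
      intro i hi j hj h hij
      have := hper (j - i) (by omega) (hcancel i _ (by rw [Nat.add_sub_cancel' hij.le, h]))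
      omega
    intro i hi j hj h
    have h1 := aux i hi j hj h
    have h2 := aux j hj i hi h.symm
    omega
  have h9 : s^[9] w = w := by
    have hsub : (Finset.range 9).image (fun i => s^[i] w) ⊆ (Finset.range 10).erase v := by
      intro x hx
      obtain ⟨i, -, rfl⟩ := Finset.mem_image.1 hx
      simpa [and_comm] using hiter i
    have heq := Finset.eq_of_subset_of_card_le hsub (by
      rw [hX, Finset.card_image_of_injOn fun i hi j hj =>
        hinj i (by simpa using hi) j (by simpa using hj), Finset.card_range])
    have hmem : s^[9] w ∈ (Finset.range 9).image fun i => s^[i] w := by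
      rw [heq]; simpa [and_comm] using hiter 9
    obtain ⟨i, hi, h⟩ := Finset.mem_image.1 hmem
    have hi := Finset.mem_range.1 hi
    have := hper (9 - i) (by omega) (hcancel i _ (by rw [Nat.add_sub_cancel' hi.le]; exact h.symm))
    have : i = 0 := by omega
    subst this
    exact h.symm
  set h : ℕ → ℕ := fun i => if i = 0 then v else s^[i - 1] w with hh
  have hlt : ∀ i < 10, h i < 10 := fun i _ => by
    simp only [hh]; split_ifs
    exacts [hv, (hiter _).1]
  obtain ⟨g, hg⟩ := exists_inverse hlt fun i hi j hj he => by
    simp only [hh] at he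
    split_ifs at he with h1 h2 h2
    · omega
    · exact absurd he.symm (hiter _).2
    · exact absurd he (hiter _).2
    · have := hinj (i - 1) (by omega) (j - 1) (by omega) he
      omega
  refine ⟨g, h, hg, fun i hi h0 => ⟨by simp, hi, by simp only [nxt]; omega, ?_⟩⟩
  have h1 : h i = s^[i - 1] w := if_neg h0.ne'
  have h2 : h (nxt i) = s^[i] w := by
    rcases Nat.lt_or_ge i 9 with h3 | h3
    · simp [hh, nxt, Nat.mod_eq_of_lt h3]
    · obtain rfl : i = 9 := by omega
      simpa [hh, nxt] using h9.symm
  have h3 := hO' (i - 1)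
  rw [Nat.sub_add_cancel h0] at h3
  rw [h1, h2]
  exact h3

theorem models_of_card_missing {Ts : List (List ℕ)} {os : List ℕ}
    (hroots : rootsOK Ts (choose 3 chords) os = true) (hO : IsRot O) (h6 : (missing O).card = 6) :
    Models Ts O := by
  obtain ⟨g, h, hgh, hst⟩ := exists_star hO h6
  refine models_of_transport hO hgh (models_of_star hroots (hO.transport hgh) hst ?_)
  have := sum_missing_transport hO hgh fun _ => 1
  simpa [h6] using this

end

/-! ### The rotation system of an oriented surface -/

/-- The map `ω` is an orientation of the surface `S`. -/
structure IsOrientation {n : ℕ} (S : TriSurface n) (ω : Finset (Fin n) → Finset (Fin n × Fin n)) :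
    Prop where
  cyclic : ∀ f ∈ S.faces, ∃ a b c : Fin n, a ≠ b ∧ a ≠ c ∧ b ≠ c ∧
    f = {a, b, c} ∧ ω f = {(a, b), (b, c), (c, a)}
  disjoint : ∀ f ∈ S.faces, ∀ g ∈ S.faces, f ≠ g → ∀ p ∈ ω f, p ∉ ω g

/-- The cyclically ordered triple `(a, b, c)` is an oriented triangle. -/
structure IsOriented {n : ℕ} (S : TriSurface n) (ω : Finset (Fin n) → Finset (Fin n × Fin n))
    (a b c : Fin n) : Prop where
  ne₁₂ : a ≠ b
  ne₁₃ : a ≠ c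
  ne₂₃ : b ≠ c
  mem : {a, b, c} ∈ S.faces
  eq : ω {a, b, c} = {(a, b), (b, c), (c, a)}

theorem rotate_triple {α : Type*} [DecidableEq α] (a b c : α) :
    ({b, c, a} : Finset α) = {a, b, c} := by
  ext x; simp only [Finset.mem_insert, Finset.mem_singleton]; tauto

section

variable {n : ℕ} {S : TriSurface n} {ω : Finset (Fin n) → Finset (Fin n × Fin n)} {a b c d : Fin n}

theorem IsOriented.rotate (h : IsOriented S ω a b c) : IsOriented S ω b c a where
  ne₁₂ := h.ne₂₃
  ne₁₃ := h.ne₁₂.symm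
  ne₂₃ := h.ne₁₃.symm
  mem := by rw [rotate_triple]; exact h.mem
  eq := by rw [rotate_triple, rotate_triple (a, b), h.eq]

theorem IsOriented.mem_dart (h : IsOriented S ω a b c) : (a, b) ∈ ω {a, b, c} := by
  rw [h.eq]; simp

namespace IsOrientation

theorem exists_isOriented (hω : IsOrientation S ω) {f : Finset (Fin n)} (hf : f ∈ S.faces)
    (h : (a, b) ∈ ω f) :
    ∃ c, f = {a, b, c} ∧ IsOriented S ω a b c := by
  obtain ⟨x, y, z, hxy, hxz, hyz, rfl, he⟩ := hω.cyclic f hf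
  have hO : IsOriented S ω x y z := ⟨hxy, hxz, hyz, hf, he⟩
  rw [he] at h
  simp only [Finset.mem_insert, Finset.mem_singleton, Prod.mk.injEq] at h
  rcases h with ⟨rfl, rfl⟩ | ⟨rfl, rfl⟩ | ⟨rfl, rfl⟩
  · exact ⟨z, rfl, hO⟩
  · exact ⟨x, (rotate_triple _ _ _).symm, hO.rotate⟩
  · exact ⟨y, rotate_triple _ _ _, hO.rotate.rotate⟩

theorem mem_or_mem (hω : IsOrientation S ω) {f : Finset (Fin n)} (hf : f ∈ S.faces) (ha : a ∈ f)
    (hb : b ∈ f) (hab : a ≠ b) :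
    (a, b) ∈ ω f ∨ (b, a) ∈ ω f := by
  obtain ⟨x, y, z, -, -, -, rfl, he⟩ := hω.cyclic f hf
  rw [he]
  simp only [Finset.mem_insert, Finset.mem_singleton, Prod.mk.injEq] at ha hb ⊢
  rcases ha with rfl | rfl | rfl <;> rcases hb with rfl | rfl | rfl <;> simp_all

theorem unique (hω : IsOrientation S ω) (h₁ : IsOriented S ω a b c) (h₂ : IsOriented S ω a b d) :
    c = d := by
  have he : ({a, b, c} : Finset (Fin n)) = {a, b, d} := by
    by_contra hne
    exact hω.disjoint _ h₁.mem _ h₂.mem hne _ h₁.mem_dart h₂.mem_dart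
  have hc : c ∈ ({a, b, d} : Finset (Fin n)) := by rw [← he]; simp
  simp only [Finset.mem_insert, Finset.mem_singleton] at hc
  rcases hc with h | h | h
  · exact absurd h h₁.ne₁₃.symm
  · exact absurd h h₁.ne₂₃.symm
  · exact h

theorem exists_opposite (hω : IsOrientation S ω) (h : IsOriented S ω a b c) :
    ∃ d, IsOriented S ω b a d := by
  have hcard := S.edge_two a b h.ne₁₂ ⟨_, h.mem, by simp, by simp⟩
  obtain ⟨g, hg, hne⟩ := Finset.exists_mem_ne (by rw [hcard]; simp) ({a, b, c} : Finset (Fin n))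
  obtain ⟨hg, hag, hbg⟩ := Finset.mem_filter.1 hg
  rcases hω.mem_or_mem hg hag hbg h.ne₁₂ with h' | h'
  · exact absurd h' (hω.disjoint _ h.mem _ hg hne.symm _ h.mem_dart)
  · obtain ⟨d, -, hd⟩ := hω.exists_isOriented hg h'
    exact ⟨d, hd⟩

theorem exists_isOriented_iff (hω : IsOrientation S ω) :
    (∃ c, IsOriented S ω a b c) ↔ a ≠ b ∧ ∃ f ∈ S.faces, a ∈ f ∧ b ∈ f := by
  constructor
  · rintro ⟨c, h⟩
    exact ⟨h.ne₁₂, _, h.mem, by simp, by simp⟩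
  · rintro ⟨hab, f, hf, ha, hb⟩
    rcases hω.mem_or_mem hf ha hb hab with h | h
    · obtain ⟨c, -, hc⟩ := hω.exists_isOriented hf h
      exact ⟨c, hc⟩
    · obtain ⟨c, -, hc⟩ := hω.exists_isOriented hf h
      exact hω.exists_opposite hc

theorem mem_of_closed (hω : IsOrientation S ω) (v : Fin n) {A : Finset (Fin n)} (hA : A.Nonempty)
    (hsucc : ∀ x ∈ A, ∃ y ∈ A, IsOriented S ω v x y) {x y : Fin n} (hxy : IsOriented S ω v x y) :
    x ∈ A := by
  choose! s hs using hsucc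
  have hsurj := Finset.surjOn_of_injOn_of_card_le s (fun x hx => (hs x hx).1)
    (fun x hx y hy he => by
    have h₁ := (hs x hx).2.rotate.rotate
    rw [he] at h₁
    exact hω.unique h₁ (hs y hy).2.rotate.rotate) le_rfl
  obtain ⟨w, hw⟩ := hA
  have hreach := S.link_cycle v w x
    ⟨_, (hs w hw).2.mem, by simp, by simp, (hs w hw).2.ne₁₂.symm⟩
    ⟨_, hxy.mem, by simp, by simp, hxy.ne₁₂.symm⟩
  clear hxy
  induction hreach with
  | refl => exact hw
  | @tail p q _ h ih =>
    obtain ⟨hpq, hpv, hqv, hf⟩ := h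
    have third : ∀ r, ({v, p, q} : Finset (Fin n)) = {v, p, r} → q = r := by
      intro r he
      have hq : q ∈ ({v, p, r} : Finset (Fin n)) := by rw [← he]; simp
      simp only [Finset.mem_insert, Finset.mem_singleton] at hq
      exact (hq.resolve_left hqv).resolve_left hpq.symm
    rcases hω.mem_or_mem hf (a := v) (b := p) (by simp) (by simp) hpv.symm with h | h
    · obtain ⟨r, he, hr⟩ := hω.exists_isOriented hf h
      obtain rfl := third r he
      rw [hω.unique hr (hs p ih).2]
      exact (hs p ih).1
    · obtain ⟨r, he, hr⟩ := hω.exists_isOriented hf h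
      obtain rfl := third r (by rw [he, Finset.insert_comm])
      obtain ⟨u, hu, rfl⟩ := hsurj ih
      rw [hω.unique hr (hs u hu).2.rotate.rotate]
      exact hu

theorem card_dart (hω : IsOrientation S ω) {f : Finset (Fin n)} (hf : f ∈ S.faces) :
    (ω f).card = 3 := by
  obtain ⟨a, b, c, hab, hac, hbc, -, he⟩ := hω.cyclic f hf
  rw [he, Finset.card_eq_three]
  exact ⟨_, _, _, by simp [hab], by simp [hac], by simp [hbc], rfl⟩

end IsOrientation

/-- The ordered pairs of adjacent vertices. -/
noncomputable def darts (S : TriSurface n) : Finset (Fin n × Fin n) :=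
  Finset.univ.filter fun p => p.1 ≠ p.2 ∧ ∃ f ∈ S.faces, p.1 ∈ f ∧ p.2 ∈ f

theorem mem_darts : (a, b) ∈ darts S ↔ a ≠ b ∧ ∃ f ∈ S.faces, a ∈ f ∧ b ∈ f := by
  simp [darts]

theorem IsOrientation.card_darts (hω : IsOrientation S ω) : (darts S).card = 3 * S.faces.card := by
  have h : darts S = S.faces.biUnion ω := by
    ext ⟨a, b⟩
    rw [mem_darts, ← hω.exists_isOriented_iff, Finset.mem_biUnion]
    constructor
    · rintro ⟨c, h⟩
      exact ⟨_, h.mem, h.mem_dart⟩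
    · rintro ⟨f, hf, h⟩
      obtain ⟨c, -, hc⟩ := hω.exists_isOriented hf h
      exact ⟨c, hc⟩
  rw [h, Finset.card_biUnion fun f hf g hg hfg =>
      Finset.disjoint_left.2 fun p hp => hω.disjoint f hf g hg hfg p hp,
    Finset.sum_const_nat fun f hf => hω.card_dart hf, mul_comm]

theorem card_darts_eq_two_mul (S : TriSurface n) : (darts S).card = 2 * S.edges.card := by
  have hmem : ∀ e, e ∈ S.edges ↔ e.card = 2 ∧ ∃ f ∈ S.faces, e ⊆ f := by simp [TriSurface.edges]
  have hpair : ∀ {e : Finset (Fin n)} {a b : Fin n}, e.card = 2 → (a, b) ∈ e.offDiag →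
      e = {a, b} := by
    intro e a b he h
    obtain ⟨ha, hb, hab⟩ := Finset.mem_offDiag.1 h
    refine (Finset.eq_of_subset_of_card_le (fun x hx => ?_) ?_).symm
    · simp only [Finset.mem_insert, Finset.mem_singleton] at hx
      rcases hx with rfl | rfl <;> assumption
    · rw [he, Finset.card_pair hab]
  have h : darts S = S.edges.biUnion Finset.offDiag := by
    ext ⟨a, b⟩
    rw [mem_darts, Finset.mem_biUnion]
    constructor
    · rintro ⟨hab, f, hf, ha, hb⟩
      refine ⟨{a, b}, (hmem _).2 ⟨Finset.card_pair hab, f, hf, fun x hx => ?_⟩, by simp [hab]⟩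
      simp only [Finset.mem_insert, Finset.mem_singleton] at hx
      rcases hx with rfl | rfl <;> assumption
    · rintro ⟨e, he, h⟩
      obtain ⟨ha, hb, hab⟩ := Finset.mem_offDiag.1 h
      obtain ⟨-, f, hf, hef⟩ := (hmem e).1 he
      exact ⟨hab, f, hf, hef ha, hef hb⟩
  rw [h, Finset.card_biUnion fun e he e' he' hne => Finset.disjoint_left.2 fun p hp hp' =>
      hne ((hpair ((hmem e).1 he).1 hp).trans (hpair ((hmem e').1 he').1 hp').symm),
    Finset.sum_const_nat fun e he => by rw [Finset.offDiag_card, ((hmem e).1 he).1], mul_comm]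

end

/-- The rotation system of a surface with ten vertices. -/
def rotation (S : TriSurface 10) (ω : Finset (Fin 10) → Finset (Fin 10 × Fin 10)) (a b c : ℕ) :
    Prop :=
  ∃ x y z : Fin 10, x = a ∧ y = b ∧ z = c ∧ IsOriented S ω x y z

section

variable {S : TriSurface 10} {ω : Finset (Fin 10) → Finset (Fin 10 × Fin 10)}

theorem rotation_val {x y z : Fin 10} : rotation S ω x y z ↔ IsOriented S ω x y z := by
  constructor
  · rintro ⟨x', y', z', hx, hy, hz, h⟩
    obtain rfl := Fin.ext hx
    obtain rfl := Fin.ext hy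
    obtain rfl := Fin.ext hz
    exact h
  · exact fun h => ⟨x, y, z, rfl, rfl, rfl, h⟩

theorem isRot_rotation (hω : IsOrientation S ω) : IsRot (rotation S ω) where
  lt := by rintro a b c ⟨x, y, z, rfl, rfl, rfl, h⟩; exact x.2
  cyc := by rintro a b c ⟨x, y, z, rfl, rfl, rfl, h⟩; exact rotation_val.2 h.rotate
  ne := by rintro a b c ⟨x, y, z, rfl, rfl, rfl, h⟩; exact Fin.val_ne_of_ne h.ne₁₂
  uniq := by
    rintro a b c d ⟨x, y, z, rfl, rfl, rfl, h⟩ ⟨x', y', w, hx, hy, rfl, h'⟩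
    obtain rfl := Fin.ext hx
    obtain rfl := Fin.ext hy
    rw [hω.unique h h']
  opp := by
    rintro a b c ⟨x, y, z, rfl, rfl, rfl, h⟩
    obtain ⟨d, hd⟩ := hω.exists_opposite h
    exact ⟨d, rotation_val.2 hd⟩
  link := by
    rintro _ A ⟨w, hw⟩ hA _ _ ⟨v, x, y, rfl, rfl, rfl, h⟩
    have hmem : ∀ u : Fin 10,
        u ∈ Finset.univ.filter (fun u : Fin 10 => (u : ℕ) ∈ A) ↔ (u : ℕ) ∈ A := by
      simp
    refine (hmem x).1 (hω.mem_of_closed v ?_ (fun u hu => ?_) h)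
    · obtain ⟨_, _, v', w', -, -, rfl, -, -⟩ := hA w hw
      exact ⟨w', (hmem w').2 hw⟩
    · obtain ⟨_, hq, v', u', q', hv, hu', rfl, h'⟩ := hA u ((hmem u).1 hu)
      obtain rfl := Fin.ext hv
      obtain rfl := Fin.ext hu'
      exact ⟨q', (hmem q').2 hq, h'⟩

theorem card_missing_rotation (hω : IsOrientation S ω) (hχ : S.eulerChar = -4) :
    (missing (rotation S ω)).card = 6 := by
  have h₁ : missing (rotation S ω) = ((Finset.univ : Finset (Fin 10)).offDiag \ darts S).map
      (Fin.valEmbedding.prodMap Fin.valEmbedding) := by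
    ext ⟨a, b⟩
    have hadj : ∀ x y : Fin 10, Adj (rotation S ω) x y ↔ ∃ z, IsOriented S ω x y z := fun x y =>
      ⟨fun ⟨c, hc⟩ => by
        obtain ⟨_, _, z, -, -, rfl, -⟩ := id hc
        exact ⟨z, rotation_val.1 hc⟩, fun ⟨z, hz⟩ => ⟨z, rotation_val.2 hz⟩⟩
    rw [mem_missing, Finset.mem_map]
    constructor
    · rintro ⟨ha, hb, hab, hn⟩
      refine ⟨(⟨a, ha⟩, ⟨b, hb⟩), ?_, rfl⟩
      rw [Finset.mem_sdiff, mem_darts, ← hω.exists_isOriented_iff, ← hadj]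
      exact ⟨by simpa using hab, hn⟩
    · rintro ⟨⟨x, y⟩, h, he⟩
      obtain ⟨rfl, rfl⟩ := Prod.mk.inj he
      rw [Finset.mem_sdiff, mem_darts, ← hω.exists_isOriented_iff, ← hadj] at h
      exact ⟨x.2, y.2, Fin.val_ne_of_ne (by simpa using h.1), h.2⟩
  have h₂ : darts S ⊆ (Finset.univ : Finset (Fin 10)).offDiag := fun ⟨a, b⟩ h => by
    simpa using (mem_darts.1 h).1
  have h₃ := hω.card_darts
  have h₄ := card_darts_eq_two_mul S
  have h₅ : (10 : ℤ) - S.edges.card + S.faces.card = -4 := hχ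
  rw [h₁, Finset.card_map, Finset.card_sdiff_of_subset h₂, Finset.offDiag_card, Finset.card_univ,
    Fintype.card_fin]
  omega

theorem exists_realization (hω : IsOrientation S ω) (hχ : S.eulerChar = -4) {Ts : List Template}
    {os : List ℕ} (hTs : ∀ T ∈ Ts, T.ok = true)
    (hroots : rootsOK (Ts.map Template.tris) (choose 3 chords) os = true) :
    ∃ p : Fin 10 → Fin 3 → ℝ, S.IsRealization p := by
  obtain ⟨_, hmem, σ, hσ, hinj, hS⟩ := models_of_card_missing hroots (isRot_rotation hω)
    (card_missing_rotation hω hχ)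
  obtain ⟨T, hT, rfl⟩ := List.mem_map.1 hmem
  refine ⟨_, isRealization_of_template S (hTs T hT) hσ hinj fun F hF => ?_⟩
  obtain ⟨a, b, c, hab, hac, hbc, rfl, he⟩ := hω.cyclic F hF
  exact ⟨a, b, c, rfl, hS _ _ _ (rotation_val.2 ⟨hab, hac, hbc, hF, he⟩)⟩

end

/-! ### The twenty realized surfaces -/

/-- A realization of the surface number 1. -/
def template1 : Template :=
  ⟨[
    7, 515, 13, 25, 49, 97, 193, 385, 769, 22, 42, 138, 274, 546, 194, 322, 140, 84, 164, 292,
    580, 772, 88, 296, 328, 176, 400, 608],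
    333938991453419891700867969864471443852391822054159355, [
    151538281629171027873180, 150271199483713596993683, 150195129184591607780584,
    151115152679376452668840, 151004472212734095161824, 150739293517859808171170,
    151243128067032370164049, 151142821671786145809998, 151178563363230410443165,
    151258113822248961043205, 151235056519155235852060, 151024071879411922116088,
    151306539898750733134165, 149317748039376032235770, 151162422462164841090220,
    151214303933170683397966, 150698950260311250720224, 151342277096483307357982,
    151369951713994609856316, 151176257516926956775893, 150089038995393987819665,
    151207387525645976825252, 151403387559128870014084, 151309998667657063369533,
    151054051212933959604649, 151404539361330731306764, 151379168325144534036753,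
    149521818513500126319858, 151021766036402709469688, 151180869205142260033909,
    151352657888127913413004, 150834992749355733628386, 151492163645283152022924,
    151193560352182939700460, 151515216435999010365717, 151158963697651288722604,
    151062117166460432568040, 150750829478418831652338, 151042524247488685754793,
    151560187135560709163277, 152240429954779092446340, 151507126874835847128582,
    139765590853174648141346, 151092093125581347245740, 151201621795520496717388,
    151052896044026513851900, 151213151011666093311822, 151179716283638323620213,
    150913391414967517578494, 151220070786997051551136, 151307692825745213837100,
    151210845164263111306069, 151341124174978767554334, 151348042831004703297100,
    151518674084492357136128, 150976800976214738362088, 151308847993554233543076,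
    151259268992260217381749, 151312304507372037638493, 151681246106918115123665,
    151132446503045062725116, 151135904142758756124254, 151139362907272308491870,
    151202773590026758647556, 151207387526743378971784, 151263878429772536342785,
    151168187070785243696264, 151025224800916545740264, 151029836486934956367336,
    151243128094487979577100, 150952590745025712256482, 151033296376249239231912,
    151305386981637578919820, 151051744245124417722809, 151052897166628957526457,
    151309998668755568298813, 151311151590260109151036, 151306539900944362604821,
    151005627384939007184376, 151369951711796661946652, 151273104051413465598237,
    151496775329097863515144, 151052898291429369518505, 151378023288229218814396,
    151183175045954669291793, 150825770502119276164576, 150859206352752276411896,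
    151496775328005880383757, 151260421913764855688021, 151539434550675601198492,
    150881105101546897127553, 150843066577585810459880, 151580938596744690370821,
    150864968697483869386912, 151758493014253861832972, 151477182410125990251936,
    151674310615113191105027, 151727342753624786203136, 150649380259612177554592,
    150165121724474202657363, 150167434305284221989058, 150858066927755051223464,
    150588257426346535670914, 150735833597778451888129, 151631642399534548943383,
    149845762445698236477570, 152092845873514338715997, 152888376365972780552076,
    150025623859561344357512, 148832397325246046668280, 153736935554494815667061,
    149948396107902121410814, 150911081073848718578826, 150509866623360161051043,
    150557124039944463061851, 150755431041236922962779, 150521382348500416762459]⟩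

/-- A realization of the surface number 2. -/
def template2 : Template :=
  ⟨[
    7, 515, 13, 25, 49, 97, 193, 385, 769, 22, 42, 74, 50, 578, 524, 276, 164, 292, 196, 580, 152,
    552, 328, 392, 656, 784, 352, 672],
    1072174043176181851259787283225457233719730629455941688, [
    151462184310664455329306, 151267339446086707675675, 151341127549380961206814,
    151050591324718718181703, 152457189361495014811398, 151169339992291187828278,
    151059814700050358093670, 151255810235430225602150, 151175103473915121316914,
    151183175049249105883667, 151058659524551201440079, 151158963696553118906641,
    151153199089029547801361, 151156658978343766171925, 151265034726776230356242,
    151093250546288542540614, 151124374926614048576155, 151177410442824249706038,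
    151218917867691463378718, 151324986647216952680983, 150982568957043741345742,
    151177410442823184884774, 151243126969687416968762, 150977956145125441291598,
    151040213901982598662405, 151186632691158131959462, 152009814153958596621872,
    151192398422385203971742, 151229293036430651270166, 151217764946186923575070,
    151176257522417015334502, 151229294159033902279956, 151276563941823368901394,
    154367538667204183003674, 155017772896011532317232, 151111693915956770991396,
    151322680804207747367447, 150977957271025347479502, 151323833727910328731294,
    151088635482575762264923, 151462185436556712420374, 150874187580205087485024,
    151834571206760216244753, 150822316224727443278089, 149780121278299511095629,
    151177409316924337108016, 151034448172953392300359, 151099011777213522742037,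
    151192398422386344755871, 151207386401948318335707, 151048285481708967617351,
    151122070207308939563803, 151018309524785528456558, 151363034187162636912254,
    151442584646182404163126, 151345741481702179713299, 151440281046179989667600,
    151351507214025077006611, 150871891868100050585550, 150632068429245821253697,
    151454113866715888903206, 152000558147323970263216, 147865008360487427536961,
    154851872667185138771718, 151140515827678479618585, 151118611443890336227591,
    151187786736366776582815, 151037906938565642306926, 151194703141691461994166,
    151323830350209536701968, 151209691121250206573730, 151095554137500091065173,
    151225835394520083834132, 151233905845052333862160, 151113999756775622083355,
    151050589071822077806861, 151020613111602800740609, 151363034186065540941438,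
    151351504964424819783952, 151365340030171858994806, 151081720203146831244053,
    151075955595623729900373, 151351504969921907950494, 151353810812931053553566,
    150977958396923115881798, 150562892020768869206253, 151411458015160881416094,
    151016002549287928170781, 151426445994721778172830, 151147438989495748274022,
    151544046232296518565136, 151576328034426048199440, 150866128385377412744014,
    151269650909800970821909, 150763500369164584108777, 151426432493814215415472,
    151823049878496023488050, 151682401316450583421714, 151787318309150566097926,
    150976807715136067512597, 150701262860913045816654, 151349195745938328556187,
    150410702990171160828033, 151200452005301049906344, 151568241855356882674914,
    152806516698345376940830, 154411410431288810910226, 147519152169791781497153]⟩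

/-- A realization of the surface number 3. -/
def template3 : Template :=
  ⟨[
    7, 515, 13, 25, 49, 97, 193, 385, 769, 22, 42, 74, 274, 290, 194, 642, 140, 532, 164, 292,
    772, 88, 552, 648, 176, 592, 400, 608],
    645029486086874439307770245855421273324307974051572732, [
    151162424712865176430997, 151162423586966443993397, 151352660135533976690997,
    151207386404140895730656, 151263880681570752346529, 151127839318425628551445,
    150974497380607363034896, 151157817528246254274965, 151097859982705104760596,
    151218915616993309188519, 153177714654017430548547, 151172797630905906951874,
    151322680805302955408129, 151192398419088821420059, 151259270118156901523735,
    151478326339819391744705, 151356113279336839508609, 151289244956869028510625,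
    152246178822837441216935, 151107081105142259398626, 151214303932070131694273,
    151389546877071603003907, 151456416325438312804866, 151093247171886281965520,
    151443737557804174475303, 151154352011632727144721, 151183175049249106243763,
    151169339988995606550553, 151335362940757374482577, 151226987191226445013299,
    151393010145180756605824, 151276563939627568701461, 151322681926811292217619,
    150332379765288164462484, 151150893247118772386193, 151063271211668066111388,
    151254655058834115391619, 151005625135338213280572, 151273104053608680862115,
    151333057097748127234225, 150811935445163553460028, 150848831185109813104412,
    151104775262133028927474, 151006778056842819079996, 151216609773983021756835,
    151185479767460415815847, 151153199092324862278640, 151251197421317028870881,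
    151171645832004828633105, 151213151009470291190695, 151214303930974881276839,
    151230445955740261364019, 151565943870575119562242, 151470257009695935543441,
    151263879556775716930471, 151231597748048591034377, 151284632143860242399663,
    151577479835527248951457, 149805430448255170969916, 154879501099792540498177,
    149437592252607105390144, 140632536037775385052872, 151125528974017429572533,
    151132446503045062273973, 151175103473915187754626, 151176256395419863873024,
    151126680769623463903407, 151102469419123819423730, 151184327970753614786577,
    151087481439562852483056, 151131294706340851190173, 151217762696583918713537,
    151143975715893187414040, 151213151008370784542883, 151393005641585960415235,
    151282327424547232231459, 151223527303011740770723, 151326139569817044384257,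
    151158963694354634348568, 151230447081639228553521, 151055203012933518953372,
    151211996966457635272416, 151240821122284464881667, 151161272919455238765456,
    150870734442998047837980, 151268493490193758400785, 151266187647184542609683,
    151058664027049705965981, 151358421369755607310515, 150959511650653026093340,
    151413761605273655537827, 151118618197089109215645, 151420680262397357732771,
    150524856859121265674557, 151292709348679133281040, 151568256464588833894817,
    151328446533236123480083, 151397620698714068692995, 151413761605276612518307,
    151410302835266979438643, 151622444904495590799873, 151139374160771142486421,
    151383784520263382663599, 151102470554910754616290, 150904163552519814923238,
    151341125283298239561737, 152767290347771079946241, 152393760652291652270241,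
    149685504121240241065676, 154405589590295640864384, 153394516795455901514256,
    150983718511837303551984, 149953004408537132566012, 150610171926761087568253]⟩

/-- A realization of the surface number 4. -/
def template4 : Template :=
  ⟨[
    7, 515, 13, 25, 49, 97, 193, 385, 769, 22, 42, 74, 274, 162, 322, 642, 76, 532, 164, 548, 196,
    536, 296, 392, 648, 304, 608, 832],
    159898000019164673849617661526187166550744201669473431, [
    151142821670688228669920, 151244279890092514366952, 151254656183635056023010,
    151533667694647026849050, 151194704265393612723258, 151047130311700939505691,
    151001013448222991067477, 151457573748343589999898, 150977957267732158906709,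
    151393016886303876725089, 151165881225581297170913, 151209691119055473244130,
    151032143454742418213964, 151094400093391962674011, 151117458522386735964535,
    151252350340624760298888, 151217766076480514888507, 151366495195786133510520,
    151254655059931077366826, 151441430595480555445416, 151517526792483254228042,
    151230448206440598999385, 151029839861333999142985, 150863811296555741676090,
    150607873959537625974796, 151047130309502994139205, 151282326298650931655139,
    151738887723569879047432, 151200468871819030967778, 151045977390196328464415,
    151195858313896362383162, 151100165827912805093403, 151047130308407902873973,
    151184330224749061738618, 151320376084900482653688, 150912239614971749738869,
    151157810776146415621464, 151259266744852006401186, 151176258647218468033658,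
    150908781976356234330487, 152150463835294258255016, 147180197768650920438357,
    151141669875081917665627, 151115152679376465336649, 151190092579374916900154,
    151122070208405163354485, 151198163028809800496626, 151173951676113545132481,
    151185482017059665088881, 151190092577180188434919, 151185482015961216776513,
    151463338355866557191450, 151462183182564292386208, 151006779181640060947468,
    151426445990323781508424, 151005631892931844673883, 151177417201515304980539,
    151520968661919458684320, 150793460544821850598276, 154990153421162587706634,
    147875386951998110016133, 151140515827678479152097, 151141668749183083903969,
    151093247171887393538907, 151183175049248837754344, 151070188741794686533659,
    151084022675049066992154, 151050589074020563558775, 151277715739626034599242,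
    151281174504139838379338, 151047131434304479594821, 151188939655675598348775,
    151209695621550290408472, 151160119993556830689608, 151254658433237055445360,
    151393009015988932861248, 151062120544159108829787, 151036755140760849796168,
    151436816662057424589994, 150908780851555301753175, 151469102963389876638730,
    151522138478501413442634, 151033297501047425517640, 151208542703344148682362,
    151593621863585779995720, 151589005675070724103304, 151025230432611361493339,
    150977957267724640898116, 151172803262599096373307, 151280026090627804567162,
    151254660692725924434747, 151280027216526906365050, 150773885664395931911192,
    151314614863863599010618, 151614366567189659546592, 150071740697809306854069,
    150834981483770585606340, 151393016908272684241723, 151613219270790853698019,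
    152820344992187072304138, 149663604216888274512453, 150562882992692182968388,
    150701268475014565252160, 148210921991864678744695, 150969856410230630412164,
    152223088892768086776840, 152292284366860520582464, 147450014033093495523349,
    148994860169474013784197, 152292347417255303717235, 143714487559572341260855,
    150930685239730276106270, 150846517468489079819800, 151156664614430738157595,
    151194713276981049167931]⟩

/-- A realization of the surface number 5. -/
def template5 : Template :=
  ⟨[
    7, 515, 13, 25, 49, 97, 193, 385, 769, 22, 42, 74, 146, 162, 578, 524, 84, 164, 548, 324, 388,
    88, 296, 776, 560, 656, 352, 704],
    770605876975547807854841111160408292253775615052853587, [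
    151153197964229203011206, 151238515284769037890802, 151157810773948464873998,
    151320373840794172003442, 151313459680672167182891, 150908779727848506315593,
    151161269541759812507194, 151182021002943840199858, 151090941328877136017697,
    153260806096782659032184, 151075953349317179890025, 151312302258866598257718,
    150973343332108098261323, 150508695705044080307268, 151191246625680992309947,
    151275414393618321593610, 151157811902045246674218, 151182022129942180795514,
    151149740330011137679352, 151202776961129410458370, 151288095405369649747746,
    151185479768557169686256, 151231597752443398874790, 151138212237565376534833,
    151184330221453746197419, 151299624628112291402363, 151119765491294849225643,
    151170492914896245888634, 151172798754607897986574, 151200469997717848265274,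
    151295007310397471302790, 151403383057732586005638, 151205083938830395514168,
    152233495551560177231522, 151116305601979495436585, 151127834814828148683011,
    151187787862265877960250, 151247737528707504382994, 151246584607202893341718,
    151116305598682036429059, 151198164155808212062907, 151137059316060761299257,
    151069035821386902961504, 151184329093354816263946, 150975649175116775608651,
    150810783652848773781825, 152430633900638948566256, 151172838169862126309675,
    151097857733105388501361, 151183173924448442856626, 151126681893323004965635,
    151168187068589437044270, 151142822799883986148216, 151182024378444536693675,
    151379172832034779637298, 151439124750275808027686, 151487547453469967082534,
    150830370932442250930373, 150758887562742997723380, 150472954031193075494100,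
    151140516952478344007939, 151153199091227498517114, 151156657855741318010490,
    151182022128843813553850, 151182021004043359618802, 151183173925547953895154,
    151033295251448306782475, 151027530643924668568395, 151139365159069975001393,
    151089787284771099515248, 151185482020354903381304, 151143975721389128818040,
    151320371584598451008530, 151316912820084496250002, 151065577056873083468128,
    151071341664396150209856, 151146283813996465961249, 151259271248451968438971,
    151388393954470739653778, 151436816656565772723206, 151330754632435689542690,
    151185482023653371548664, 151052896046220234619168, 151255814734635447030059,
    151296165863598604948091, 151316918451781040870010, 151557876790052889519110,
    151407997002144842782266, 151152050674415605332256, 151229296417425492417840,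
    151595923203003550872626, 151118610306999004946438, 151050589061923257180418,
    151738882096274638451856, 151795376374801975030802, 151050595819521753432843,
    150320789758290476145513, 150794629232201474632708, 151267348455473195718945,
    151047113424319033935572, 151183176188325805047056, 152361458587271313597460,
    153675786857342806500356, 151847245436763476656798, 153153580951049206825659,
    150424552693707090973673]⟩

/-- A realization of the surface number 6. -/
def template6 : Template :=
  ⟨[
    7, 515, 13, 25, 49, 97, 193, 385, 769, 22, 42, 74, 82, 162, 642, 76, 532, 164, 548, 196, 536,
    296, 392, 648, 304, 336, 608, 832],
    1364878909503381222401586444815610857826553672639818659, [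
    151195856060999151524185, 151451810260129835549726, 149604798490018090875360,
    150695483628786624320169, 151192401800079706789386, 150818854098992621848134,
    150981413782643030794839, 151397621827908169072923, 151055200761135818540606,
    151182022128842148517002, 151398771375008365877560, 150722008692602534454822,
    151184327972949246956714, 151295010688096100651803, 151164728306271418441352,
    151576328041023653712219, 151583235450134210353321, 151154350885733768268117,
    151171644708302929706256, 151217762695486588522779, 151002166370824391935566,
    150975649175120004940375, 151211999211664408290834, 149454936706607418270369,
    151065577055774644205218, 151214305056872707789627, 151456417451338487241784,
    148684751322828196948309, 151192398422384130854971, 150988331314966002205359,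
    151223527304106955576504, 151316912821181994310968, 150853439494530012701286,
    151504845779631054757392, 151481782850339479687224, 151381480922447770190942,
    150675891831319696918118, 151165880100779828362576, 151102470542825773041182,
    151185480892258320089119, 151167034149280640523904, 151247739780504628993048,
    149934537421335784093920, 153679292890956169707547, 151194703139494511122809,
    151182022126645256104980, 151232750673948006061402, 151252350341724406092091,
    151318065742686500625688, 151311151589157375548952, 151327290237327917094232,
    151399924296512971676984, 150806169711742693024375, 151389550254768136197274,
    151037910317357393606272, 151487551953772065490718, 148687105576190578139735,
    141331512403411952075335, 142127085674524743960110, 151199315951411806539802,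
    151182022127744767459615, 151122071335402438328891, 151176257519121687094804,
    151178563362130898693652, 150999860527815179289166, 150998707606310571393615,
    151208539321251750978582, 151116304478276998749352, 151187787862262522699272,
    151366489568485634116944, 151365336646981014687068, 151444892735492128742416,
    151199317072915796045316, 151411452382365976533328, 151522135104100363997241,
    151156657859034487280296, 151368795408197709638676, 151194708768987770328602,
    151426445992522753938267, 151278870906335534753284, 151414922405873524867611,
    151510610392654591103163, 151422987221411868159504, 151620135682697580908827,
    151228133357340206989653, 150537533379355676529321, 151665101876474623299899,
    151707763344350862545179, 150041779364392259871303, 151569412751699609103872,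
    151772308943004820355472, 150168592866177561422497, 150011804546542605787810,
    150261974997859886787716, 152693497743075957136512, 151444892749770741077160,
    150095979056704542638670, 152232322378145644263696, 151851901058112381321787,
    148087559418322828413605, 151192434450028093101570, 154927928332918100188168,
    150325386814208108166112, 150506407873130264879779, 150391104464773240094688,
    150682804864437842178722, 150350758968606666869413, 150514474948163958819501,
    150635540702360423006799, 150530622592544038855255, 150619386302585215154400,
    151597081752896788733448, 150508710340640991627949, 150527151449720797097092,
    150613631817175082869367]⟩

/-- A realization of the surface number 7. -/
def template7 : Template :=
  ⟨[
    7, 515, 13, 25, 49, 97, 193, 385, 769, 22, 42, 74, 274, 290, 194, 642, 524, 84, 164, 292, 324,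
    644, 88, 552, 176, 400, 608, 832],
    1053590868278404421342788111119416005997261842814237489, [
    151167033023382874456094, 151271948883599624668190, 150834993875255627378656,
    153906436441770008096915, 151236210566557569198229, 151168187069688948765139,
    151245432812695559577621, 151200468875113255536764, 151116304477178695076908,
    151185479767464136548691, 150899557480613118308260, 151157809656838210061436,
    151056350304959101145459, 151014848507375066824688, 151020613114898117902240,
    151210849667859551107793, 151271956759405641378773, 151467951171081287272661,
    151203927638528704251965, 151165881227774951542412, 151375717448511560428724,
    151239669329974059114647, 151188943033372348824273, 151397618448010496947472,
    151217763822480101035148, 151600548396521660654289, 151259268997748244679740,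
    151395312605001281156370, 151526745656528625972482, 151100164699816558934961,
    151205080560033244055613, 151169339988995740383505, 151252352591326135825043,
    151406845204337831741533, 152661208062968436785491, 151182022127744499429523,
    151170492911598650899856, 151389546877071620285446, 151093249421488147479216,
    151145133140996409014961, 148833469218246073929064, 151065574849016708203756,
    151168185944887480255518, 151176256395420801605975, 151217763821385924585621,
    151010236821356643626992, 151170492914893964709116, 151233904723548330330293,
    151254657309534954762451, 150968732771990181523380, 151194704268688659056892,
    151562486224271201514514, 151047129184690917199368, 149645154089620241217312,
    149520625085981777347692, 146552970136825024771842, 149290036373760028983406,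
    146686846393238679465700, 173261565944738122539010, 163798722738005892925621,
    151120916162100328935763, 151118610319090947469811, 151175104598716589912467,
    151162423588063707213460, 151077106268624927178624, 151125530098817816672945,
    151173951676112605658384, 151198163031005602908285, 151206233481537851951164,
    151187786736367884050903, 151167034149280095259788, 151425288569614326801426,
    151292704845086954664083, 151190095954877796594641, 151167034144888491063569,
    151165881223383347346193, 150806169709544760949728, 151223528424513597979024,
    151323835976412716905105, 151291550799882512630103, 150893792873090151116708,
    150891487030080870313956, 150743911949393338571768, 150746217792402551218168,
    151222380008802306304660, 151070193242096382782129, 151296161363293087072380,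
    151001017950719587723953, 151270803837901068053461, 151381482047246286044304,
    151835730882552811987984, 151148587396420495192849, 151029824108633386566670,
    151622441533391532591164, 150726609135013999149679, 150199737491818073300960,
    150864950701789723365707, 150558265699144219448330, 152318793747184597581830,
    152462937084946411323477, 152202341919827455545355, 150060208128138361717359,
    149724698967491059270254, 153652788128415448681604, 150600951931321228206064,
    151424133400705817805902, 150905309708735004496938, 151014846256666179522056]⟩

/-- A realization of the surface number 8. -/
def template8 : Template :=
  ⟨[
    7, 515, 13, 25, 49, 97, 193, 385, 769, 22, 42, 74, 146, 546, 322, 386, 140, 84, 164, 292, 580,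
    772, 280, 296, 200, 176, 336, 608],
    16765063597361850752467021045690953396212866147797272, [
    151198163029907198250396, 151948759976362451224745, 151172797629807536025364,
    151228138990126456480149, 151296160236295813198722, 151101317619124559023228,
    149833105099821685215403, 151337667660064597050782, 151153197965327724557075,
    151075953350416691433915, 150998707603015260177660, 151185479767457656963870,
    150851133655915623616763, 151414914524577427784990, 151993696886876015250848,
    151209691121251812243841, 151520984434395434289565, 155555100766078088317333,
    151111693915961066080429, 151149741450414560644604, 150913391417165471285499,
    151418373290190692353854, 153256103138195195209286, 151291550797682507842878,
    151277715741822894553520, 151104777508435293691072, 151102471665426071608520,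
    151108220538944225420083, 151178563363229345369220, 150986024347156376539819,
    151222375505205899513100, 151339975752672453684644, 150897251641999806496957,
    151414914528971145685397, 150997554681510651233534, 151222374380405487537420,
    151037906939665154115773, 151235056516957221848412, 151210846292356673133992,
    151275408772914848839056, 151298466079305025845122, 151194708767890508171436,
    151440281053870137351600, 152417975392563641265568, 151146281562198799620521,
    151220068538495801558942, 151071341664398268236219, 151111693913764324445308,
    151254655061030457176960, 151037906935271537770622, 150833839834445227036859,
    151459882965750734744708, 151208542694551411543116, 151471407684896407265687,
    151018308393395311609086, 151891076740976149630228, 150000264058224248257088,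
    151172798755706570919052, 151036754018160815442109, 151049435029911631917219,
    151225833147117240689047, 150977955021424541106351, 150981413785938351177897,
    150980260864433738039471, 151184327972950320429489, 151274255851410239894930,
    151233905846149731675264, 151236210566557544815024, 151280021584832107199920,
    151037906935270479760492, 151019462446290739923133, 151176259767622058134604,
    150778500727023172649131, 151124380553911606970557, 151372259804401162349732,
    151315761028872492659073, 151452958687924988388114, 151414914525676938856254,
    151295007316988620042625, 151616678040781835701508, 151448349250409983050558,
    151613214774870073912592, 151086330773153384059297, 151442585764390991693148,
    151437975210860915269048, 151471399797008126621442, 151342284964587643915276,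
    151388392836259327900032, 150705858782148234216014, 150478743386519300227245,
    151673177950999259208864, 152171246794198198324620, 151927969114215984210327,
    149881523292824968384683, 151229282917631389762327, 150834997239774492230782,
    150761210261280364692604, 151371100112126770054748, 149510291579927595057595,
    152932177247856148743966, 151632786353432045888307, 147597553110284580485248,
    144658661622828851401307, 151669716941282418956728, 150643610036880840409259,
    150369203446600870286946, 151592462196575203080066, 151309993046946240133889,
    150740443063872836186771, 150599797894905447584187, 150482199901433603035387,
    151028685810632154209352, 151900307992104864935076]⟩

/-- A realization of the surface number 9. -/
def template9 : Template :=
  ⟨[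
    7, 515, 13, 25, 49, 97, 193, 385, 769, 22, 42, 74, 146, 546, 322, 386, 76, 276, 292, 548, 196,
    644, 280, 168, 648, 776, 176, 352],
    1449180691859198502172750154144149971751395721074021899, [
    150373806129811774249080, 151110540994455393245969, 151113999756773407641288,
    151259270122550686082822, 151125531221421470305868, 149732793019050345273673,
    151095553013797326412297, 150793435794785113543736, 151182021002942762427414,
    151123222005109374608103, 151090941327779704261453, 151239668205171449212212,
    151186633815958464180016, 151373408227805041471028, 151273104054709248878566,
    151203926515924044297010, 151150895493424257289860, 151458760446843222647621,
    151149741450415701289605, 151188943034471592158023, 151184326845951978218516,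
    151198163029909581095654, 151102470539530996075724, 151277737119636204603973,
    149845725312978860512376, 151093247170786770542344, 151182023254741535107861,
    151323832602008257537798, 156931587724825307489298, 151050590201017297685357,
    151243126969685269785876, 151118611442791830904456, 151146283811801720220613,
    151105930431041617972748, 150908748202659787084938, 151122070209503611241285,
    151122069084702131827507, 151110540993358020987405, 151247738655704770618934,
    151214305056872641717126, 151131294705242414238220, 151383790147551530312198,
    151618982763389916636678, 151463339482871410780038, 150637872456346295802160,
    151116305601979522190081, 151185482018158094443013, 151180870332139530740359,
    151238515283667378711860, 151120917285801178816008, 151110542119254714736384,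
    151104777509536944016972, 151374561149309380144692, 151218920118393107507845,
    151223530681802412997392, 151162426960270340705796, 151177412686931772698240,
    151156665731542310701573, 150896085210796970087480, 150901859940435797786825,
    149041024342687996221513, 150591799389858932640264, 152499750631104315662567,
    151120917287999027430223, 151128986613729772911409, 151115152679376452569609,
    151177411567625978372743, 151185480893357580428198, 151194704265394417428358,
    151094400092291645824520, 151241974048180696460564, 151244279891190145068052,
    151228140114929332053638, 151323832598713598340100, 151462182058860198470660,
    151193550221284143740722, 151172801005309308234372, 151084030554151671841615,
    151088642240169933718349, 151086336397160717927247, 151216614275383625378693,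
    150701253853720787163977, 151501383642914291396116, 151335369693954806376964,
    151383786772052979017670, 151185479767469492273895, 151518679716193091217350,
    150712779686679241085129, 150951419810225398256792, 151127830324415148794163,
    150078675105433383869289, 150988339188553451035656, 149871136844229512548555,
    152571303825068557839376, 149898797958603551414297, 150573276163752031207628,
    151421889474494923424583, 150945654110869132943731, 153403723299874979654928,
    151658216896347555290752, 151256960908431273965360, 150833828574348528063992,
    151232764185843211594565, 151048293365207340827501, 150901850944219844056184,
    151041351067481267838128, 151693922663382850676276, 151052888174816431571319,
    151740040650561176710416]⟩

/-- A realization of the surface number 10. -/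
def template10 : Template :=
  ⟨[
    7, 515, 13, 25, 49, 97, 193, 385, 769, 22, 42, 74, 146, 546, 322, 386, 76, 276, 292, 548, 196,
    644, 536, 168, 648, 176, 784, 352],
    1448783618349237625576227952450408138210560698964552364, [
    149053722216577448301794, 151160115496552108622366, 151314609227774514376496,
    150719701722583634594956, 151186568502834413189457, 151125531222520849651560,
    151186632688963336483635, 151116306726780022312556, 151115152679376452341480,
    151186633814861112643340, 151105918043952243292305, 151086344298229935489806,
    151137057063164657152371, 151161268416958276536861, 151244279891190949850900,
    151238516407369872928548, 151119764367592824947535, 151051744245120089022088,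
    151115151555674491029022, 151187787860068750465897, 151081719079441594146464,
    152107827110845538855972, 146994570653204254298315, 151132447628943897871916,
    151199318201014709013357, 151254658433236912511800, 151160115495453671784989,
    151206232355640090796823, 151210844042755884156956, 151120919539796660340334,
    151117458527878941999631, 151153197965328135719189, 151171644710500275031068,
    151244279890092512455988, 151108235150346659688068, 151080565036435118278606,
    151209692243856950760243, 151116306725680510754344, 151246584610498206730525,
    151122070207306867432289, 151047131434300163354240, 151308850244255670751016,
    151108239660539195736911, 151172807754111883824744, 151399929916125575527200,
    151100172592099413247758, 151168187069687883320868, 151184327970753444265776,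
    151190093705274823231278, 151246585734200431980052, 151127834815928199172969,
    151185480892259124843323, 151309997541755546201124, 151265032478274946837269,
    151213151008370765017905, 151119766620490036299598, 151570560055797409868836,
    151079413244125733045134, 151595923205198716807444, 151844957627897243446576,
    152611685310496732547881, 151111693915961134696108, 151113999758970279251628,
    151115152679375512882728, 151117458524583661536079, 151142823921386919448172,
    151184327970754585039675, 151103623464328240680580, 151111693914861017099396,
    151303078887927241747476, 151245431687896774189333, 151280019334133954355989,
    151369948338492168972564, 151259271247352140333869, 151084023796555190391784,
    151194706514996283720557, 150981413782639847165640, 151111695039659935919620,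
    151111695044057982158606, 151108236279544027400078, 151396467782699477864196,
    151255811354741518311224, 151125533477614095844974, 151134756848552514831980,
    151130146288432652371564, 151266185404173574701598, 151563641404166785707028,
    151564795448274107198756, 151463340608764036468236, 151605147702034875264260,
    151319223162297447029552, 151466797115988253031712, 151413760479374027719477,
    151456416327641663218455, 151384940813961016844080, 151135900765069647548787,
    151243132592594180262761, 151237361226376723201056, 151117467528481512375918,
    151107069850543505387537, 151097862232297976491012, 151451803514631312573235,
    151124382814501842600783, 150664354741559606692996, 151570569054208897796904,
    150092506781386489484488, 151047129217658024986126, 148932664345847998995648,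
    153500549572621269936405, 151815010913611902239593, 156282591957318634286084]⟩

/-- A realization of the surface number 11. -/
def template11 : Template :=
  ⟨[
    7, 515, 13, 25, 49, 97, 193, 385, 769, 22, 42, 74, 274, 162, 322, 642, 76, 532, 164, 548, 196,
    152, 296, 392, 304, 656, 608, 832],
    170048275863833685349475182428856997586173321914073089, [
    151116317981375680006473, 151155503807238400316698, 151348051841493970458793,
    151184327975149344921848, 151125530098818353355113, 151187786737465483140280,
    151311149339559814831536, 151058659525648565848141, 151171646959003164627307,
    151185479769656681567736, 151393010141888797841689, 151141671000980750653897,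
    151296164733302749139243, 151284634393455161448729, 151324985521317046066488,
    151509452964256385963418, 151116306724581945295177, 151154353135335086674251,
    151115151560071464094972, 151060970997052701526157, 151254657309532808149376,
    151158963699848970049721, 151090942454775969269901, 151237363489161662535825,
    151185486520658075603945, 150505256069833576041037, 151116331454798615986443,
    151029836488032455026757, 151116278567214705255954, 151248892702009772865921,
    151323831472813022885136, 151126681897718988421281, 151029836485834379021125,
    151190092583774036434936, 151116310093487180857611, 151109386948151490717845,
    151123224255808736877417, 151187786734168827958074, 151182022135436518635760,
    151185496640563131863369, 151108234026646850316469, 151115151557873515628796,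
    151275409896616820841864, 151094401219289722767501, 151206234607437774428297,
    151158964821352977715531, 151275411021418273118521, 151030989407338977487685,
    151090943578479469414765, 151358421371947923922304, 151111697291461897242989,
    151359575417155553564953, 151119771121892770978793, 151539433422578819764506,
    151877255183832611164521, 148916494158232588272454, 150445306466012125472901,
    151152045042725082567994, 151116305601979497368009, 151172798755707577438523,
    151109388071852349049093, 151134753470854671784297, 151153199089030118134091,
    151185479768557438440632, 151104777511733987658061, 151168187071885824833713,
    151116304479378125622520, 151299622374112515193089, 151277715739626017774984,
    151250044498715100126608, 151142825047285886933321, 151258117199945729177729,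
    151169342241894393991659, 151179718535435453485419, 151173953927912285032939,
    151254655059934166455480, 150919156025788297382637, 151057506600846497147653,
    151116310105579124181993, 151186633818160705313784, 151187786739665847983608,
    151185479771855704299512, 151321525633101301628304, 151315761025578233839024,
    151016001426679643958021, 151323834850512877457721, 151047130305106551234821,
    151116307849383445152587, 151463339480667087558920, 151395314862294634699920,
    150979107937431840877061, 151026378845022037657869, 151116312354080939854313,
    151603998157130478229896, 151673173449604845903232, 150840757352478892288517,
    150760046103847037627012, 151327287997623533835514, 151645507831600771569961,
    150493725726688286261829, 151116311217184315263233, 151116326991878720326633,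
    152205829942336085941504, 150905289442540187526150, 150743893947083684949012,
    151899159573097286858753, 151600527028612749857976, 151538280527461954361848,
    150882276047320712530053, 150702398837856541073926, 151116303198512578028290,
    146965720375150877073412]⟩

/-- A realization of the surface number 12. -/
def template12 : Template :=
  ⟨[
    7, 515, 13, 25, 49, 97, 193, 385, 769, 22, 42, 74, 146, 162, 578, 524, 276, 164, 548, 388, 88,
    296, 776, 560, 336, 656, 352, 704],
    301772138379504798152510056097573999965163278908376414, [
    152015584389878346229382, 151216615401283802735253, 151160115494355768456434,
    151077107396720620747248, 151141671002079259798960, 150351917491047261915909,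
    151125528974017421224853, 151153199090129059553943, 151247737529805937927334,
    151431052052338169422902, 151160118873151511211252, 151254662940130812439189,
    151108235151447245269429, 151190091453477224243847, 151248891578307817845936,
    151208541578544290204924, 151171648090395262060796, 151113998634169883697144,
    151126681894422516985220, 151035602221455328688561, 150949131979413588134157,
    151394159688989941802130, 151132449876345680014596, 153184641192442699654690,
    152084745044575872370374, 150986025469758822455769, 151200468872919607706327,
    151156660104241523436820, 150893794000085208209721, 151185480892258068571270,
    151354960356733793313814, 151217766074284176124085, 151138211105076178182277,
    152999008454101327693538, 169102302446272714186900, 151131292455641622626959,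
    151126680770720559930488, 151124376051413304338820, 151137058190161928268021,
    151065579306477093432277, 150937602765463677016344, 152052475629520682427442,
    152038701304138271139973, 162668242618065464280586, 151156656729841411045106,
    151135905268657329801461, 151251196294319892685862, 151115154932274699512757,
    151298467203006983910578, 151072495710702192310769, 151250043372817365623463,
    150873039159009890322893, 151312301135166670447271, 151462180932963527386246,
    151184329101047106899704, 150657442835446701791705, 151553260609226200655410,
    151802297282621166560276, 151588994418284378243782, 150659756560842503100721,
    151516391881007102460567, 151128987737431864896772, 151171645834203305975959,
    151183175049248839147670, 151146282686999447578772, 151252350341723204691120,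
    151210845166458913531542, 151147434482607166096031, 151185479767458763268807,
    151187785610467943441095, 151112849089265552862133, 151060965367561513438085,
    151199318202113686085781, 151254656184733518866070, 151309996416954631431174,
    151250044497616636847750, 151162422462168061805215, 151048284358007019047381,
    151357266199743011202066, 151093247174084769356280, 150971038615001005853085,
    151160118868755612412948, 151398771375008499217426, 151396465531999151305874,
    151194704264299217781391, 151186637192563232121559, 151082877632646899344341,
    151323830350213896495751, 151531358476137116021906, 150769276221395378424077,
    150701253853721307126233, 150795793417096369248520, 151194708772287756372213,
    150957199056633374326048, 150493723475996731001677, 150977944886126641372168,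
    151187770974866529801248, 151243141606384127189941, 151140525948682072877316,
    150095962174808496554861, 151530195420448902398606, 152227719702619099575346,
    149755848079144308972393, 150897232514905463079659, 150960649925579886551810,
    150830358570631543394939, 147761282594076929037289]⟩

/-- A realization of the surface number 13. -/
def template13 : Template :=
  ⟨[
    7, 515, 13, 25, 49, 97, 193, 385, 769, 22, 42, 74, 146, 546, 322, 386, 76, 276, 292, 548, 580,
    536, 168, 648, 176, 784, 352, 704],
    1132715222259238635894771696234186156954150395253604404, [
    150913391406173848308245, 151236208313661432297952, 151217762693289141825827,
    151051741995521414767125, 151254656182535670264131, 150983718504147230033438,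
    151191245499781085324103, 151193550219089415272418, 151303081136430432543559,
    151452962063424607613826, 151133599425648107169558, 151018307266392403683637,
    151266189896779968520467, 151195857187997478856646, 151182022129941107029138,
    151293855514791682568641, 151266185395384728838503, 151178563366525726471312,
    151397618450208477706689, 151254659558033548620051, 151367644746182786872706,
    151252350345022839736270, 151298467195316853162343, 151185480894455061787666,
    151320372708299200133505, 151358419119051006081217, 151059812442757272939285,
    151119765486896753123591, 150980259745126672547472, 151099010654609999177426,
    151258114951446060397762, 151319223165589530341891, 151250044500914089281478,
    151265032473880658338151, 150680509103964263491845, 151115152679375375147031,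
    151245432813796142932934, 151255811355839956173647, 151240822253675473909650,
    151309996420254222280678, 151441437345385415869255, 150927224234410697328336,
    154644265665740178747681, 151185480892258185175879, 151093247169688335523861,
    151238517533267900740115, 151216609771784002298659, 151213151011665020236994,
    151323832600909937505538, 151364183726573839251585, 151391853841586166823041,
    151263881808568011432722, 151060965364262416656661, 151300774167521278522147,
    151313455184768047015906, 151047123566201413832680, 150873032400317555820649,
    151668566280369493550994, 150230864073374642677797, 151738869677316679227681,
    151801129785979701073096, 153039436066207274533647, 153869465421527441233098,
    151103622340629026356368, 151102469419123815530192, 151185480893356624179970,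
    151126681893323558592775, 151245432811597120270722, 151297317655902756794883,
    151298470577407632338947, 151088635481471956265237, 151238514159968675984834,
    151254658434335483413327, 151360724962059951601857, 151141670997684404814615,
    151245432814895654552526, 151247738657904867198926, 151236211689162161668943,
    151079413237530812720148, 151078260316026203776022, 151033295247051839447829,
    151305384733136317871042, 151307689450247209113058, 151446042279301840761217,
    151012542658869368924981, 151531357344745019701441, 151393011269985596646215,
    151344585194589820848070, 151030991656938159710229, 151586695326269303191776,
    151300779797012760997906, 151738886595473364875265, 151578636134724848054275,
    151600536009426474135907, 151042523123780283244566, 151501385881529365520643,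
    151534819480365219143971, 151632817830241133183942, 151572865913100023399374,
    151291540672289459688424, 151131285688158626928681, 152449091879512534807680,
    151805753767871078093091, 152707373306061460095823, 154342185608017695504513,
    153952537585489240191874, 151251203038721940119555, 151250050117217329078279,
    151230450450539517812743, 150892636584875512860372, 150894942427884718173908,
    150814237924758108024468]⟩

/-- A realization of the surface number 14. -/
def template14 : Template :=
  ⟨[
    7, 515, 13, 25, 49, 97, 193, 385, 769, 22, 42, 74, 50, 194, 642, 524, 148, 164, 292, 324, 580,
    88, 296, 776, 336, 400, 608, 672],
    1436994819559648674703318291685359442093877342270390460, [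
    151171648079405515862976, 148510677054173317722275, 151107082229942642200392,
    151116307853778266124228, 150725465206413913773666, 151185485395854473867204,
    151171644708302862530961, 151180868081439229020477, 151199315953611063299196,
    151115154931175192031200, 151020614241895372185448, 151064423009471790056702,
    151256963152542020844880, 151077106271921834953852, 151182024380640343019332,
    151406841825543867403676, 150673549986998043770894, 151193550220189061680444,
    151230443696244001993473, 149677482068991465903720, 151118610320189386394108,
    151127835941827032135664, 151277715739626084413204, 151232750676145955082044,
    151155503807238366112693, 151226986068620790897736, 151254657310631253679184,
    151172799879408259234753, 151036756268859783143392, 149940296420244451132430,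
    137855349350481324830818, 151186633814861096324444, 151190092579375185308756,
    151343431141689871404956, 151579783431134719840148, 151223527304106953579608,
    151022920084904619433800, 151323832602009382063388, 151120919540895366434380,
    150419936507388778791022, 152485975249962309191964, 147477542284862532685987,
    151148587404109562294224, 151120916163198867475708, 151154350885733761360821,
    151062117166463112709374, 151065577055775722229320, 151048283232108177024998,
    151161269539561829071809, 151060966494558775945190, 151183176174049233484784,
    151231597754641415278396, 151269646416091577494612, 151289243830972410040124,
    151439125880565775899672, 150697795092500653167690, 151037908079857369091324,
    151146281561100344405972, 151152046168623378644944, 151157810776146429787968,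
    151110540994456458551112, 151047130311702276623980, 151044824467594357531622,
    151124377177313213687794, 151125530098817816344562, 151259268995551502974032,
    151199314825514020047797, 151171648086000455954368, 151192399548282963406420,
    151078258069726097573116, 151116305598682098628482, 151118611441691245279106,
    151056353685938288725628, 151326139569817854324048, 151321525628704296008448,
    151323832602007243234320, 151120917282501569935106, 151171648083803578053601,
    151176259769821986585569, 151239668207373290311036, 151047132563499947052616,
    151375717445217458106192, 150849979609608509867084, 151462185434362017398032,
    151323833724615050404789, 150949134234507511222120, 150973345586104519286344,
    150891487031178402232130, 150901865576521666675686, 151531361846143593070336,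
    151102476173419462446912, 150968736148590328570850, 151323835972015724968897,
    151093249412693195027330, 150617080451890697027755, 150995255598289298542408,
    151783842658363734295477, 151047130278719076430338, 150427991186547048272291,
    150576716936942075842979, 151254647205025444268093, 149456076100851936019119,
    150161695590147892074058, 153376059920505478229264, 151200513886918130280432,
    153122407073994688827164, 153128136651119576477953]⟩

/-- A realization of the surface number 15. -/
def template15 : Template :=
  ⟨[
    7, 515, 13, 25, 49, 97, 193, 385, 769, 22, 42, 138, 146, 290, 322, 578, 140, 84, 100, 292,
    388, 280, 552, 776, 560, 336, 656, 704],
    749632016755622900970666820367005910228777060655169664, [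
    152707346269085408319328, 151109389195555372039136, 151120948797785510259952,
    151322678553506380156236, 151185480893356564942132, 151094400090095709354849,
    151093246047087228979869, 151157811902045515033716, 151102484048117439015024,
    151142821671786129231260, 151269643039494053233982, 151306536526543067956558,
    151104775262133029800093, 151115152679376464658400, 151157811900946808192880,
    151260423040759949717472, 151372254182602506307004, 151047130310602564315317,
    151260420793356701994300, 151104782010934462003824, 151116284175831307539554,
    151179717410632810507348, 151228138987929578135400, 150966425803079954479313,
    151050592451713305622577, 151251198545018986605908, 151118611447186656438677,
    151099011776114002656097, 151396470030105514766180, 151530205550241409815912,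
    151225832020119969744238, 151379171708330805271576, 151044825591294184011873,
    151127839326116339329428, 155197714156446684417892, 151037905814864760504989,
    151168188195586708483188, 151134753473051815914676, 151383786769848856132688,
    151323832600909878824212, 151102470537331705279074, 151111697289267050981350,
    149801940173948224295563, 151116304477179106789397, 151146282685900739592176,
    151120918412798449696368, 151122071334302922456688, 151322678553505306483976,
    151316913945982255471896, 151203928764428677885236, 151267337196485375886654,
    151262725510466411628350, 151329598332137075920748, 151114003135568342165748,
    151298469450413047306216, 150965272888170235890365, 151353810808535158640616,
    151456415202841402083102, 151726212334728392093536, 149317730027186245943943,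
    148556832201520389044369, 151135904142758487623582, 151185479767457773782286,
    151182023253641994873936, 151180870332137383832660, 151072494582606482930657,
    151116305600882136860646, 151118611443891342174182, 151323833725709191920912,
    151323830350209786547212, 150908779731147108393653, 151112847961168703141874,
    151212000337564448862064, 151055200764432205589397, 151322678553507455436652,
    151111695044058116892821, 151153202466726450048116, 151323834853808196816756,
    151425294195813446724720, 151109390321456356795378, 150966425809674876291741,
    151082872007541651515797, 151600538266714656910608, 151248896075313744723808,
    151178566737633747150834, 150829228150624482558653, 151047133687199552120885,
    151047131441996748655509, 150741595978786853176203, 151178568987230792465504,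
    151170497411901892343792, 151462183186962531225404, 151247743153811140650992,
    151116307859272611466133, 151454116105338140776296, 151429897995044629705792,
    151095553005006336979552, 151111700673553892387061, 151041370201178361444417,
    150286195350070332773091, 151104766248347980189770, 151047158426247625720806,
    145720564259616240960175, 151185442654500309403665, 150980324975860480228320,
    148078364247627462410909, 151185380720246248227726, 151137048065851344787480,
    151116315735067918805044]⟩

/-- A realization of the surface number 16. -/
def template16 : Template :=
  ⟨[
    7, 515, 13, 25, 49, 97, 193, 385, 769, 22, 146, 98, 290, 578, 386, 140, 276, 164, 548, 324,
    580, 536, 296, 552, 200, 328, 176, 784],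
    1149464750867411206111847244588408225857819471269825757, [
    151155503808336888606883, 151396471158196525920579, 151116305601978452563786,
    151251199668719870669698, 151324986645018197488259, 151085177847248582825760,
    151057506603046598265673, 151268492367590236676551, 151157813029038222112610,
    151117457398682899665962, 151163574259967490543851, 151165881227776059142467,
    151072494581508045205316, 150907627931145366297449, 151142822796585450271555,
    151206233479342585077959, 151334210022550194917851, 150244684547494800203312,
    151140515827678480015509, 151161270664362191813568, 150976803220326694570829,
    151330751258036378567131, 150871887363404132948809, 151086331889165195595720,
    151182022127743157269890, 151141669876178216441186, 151417222617184145634688,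
    151108234026644702721314, 150973343332109708861272, 151316916194485144254849,
    151326139566522536161923, 151075955593425784598336, 151661637485757509411011,
    149987606634345286250244, 151150893247117765310210, 151116305600881191080777,
    151161269541757598200163, 151088634361065314669864, 150937602765465823878008,
    150942215576285723394907, 151333057095551255110339, 151413762734467030979035,
    151673177947702191845635, 151185491028625212994850, 143655630137968030258232,
    151123222006207007576171, 151208540448247947457283, 151052894917028166683469,
    151101317620222736256964, 151243129219284987015938, 151095554137500088851401,
    151376869238624070793601, 151277715737430282527367, 151195858313892001902946,
    151387244411763188089035, 151384938568753970200783, 150837299718264853764969,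
    151465646455074167230939, 151661644234565219811783, 151693906910681911600304,
    152311913419987993907490, 151184327970752639399042, 151148587404108484507458,
    151111692791158791697442, 151096705934204301528012, 151099011777213514174412,
    151215457976178224266113, 151165881227774985467138, 151207386403041451077667,
    150969884567595888319321, 151278869784831509787521, 150979109065532784022363,
    151104777509536952016832, 151103624588032336781256, 151318069115989215803776,
    151278868661133308371415, 151280021582637395648967, 151265034731172694872523,
    151372257552606181847425, 151394165312989966693123, 151334210017055924875907,
    150811934320362020541304, 150868428598890329152345, 151358421371951136678359,
    151666257040978724122754, 151199313698521581125847, 151364185982766305268163,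
    150877653095728636134223, 150881111860242439914319, 151407998119251676558019,
    151115157177479733500737, 150769278473193966934857, 151295002814490118791346,
    151165884605469337736010, 151740048518671884219138, 151225828650109332566050,
    151161263919951433895986, 151265034731161423410432, 150509859874556921187896,
    150445294026190605454392, 150917996343402613181085, 150635544077861241520987,
    150428000203620692991032, 150182421173242653180030, 150469525625303115924301,
    150430328548141157094219, 150248142191600106675240, 151562492989531921019906,
    149175897056932140419197, 152573615299799963697359, 152602442806949014987395,
    154783808580829338792962, 149678634971834336940891, 151352612915873261223987,
    150815396458180735320909]⟩

/-- A realization of the surface number 17. -/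
def template17 : Template :=
  ⟨[
    7, 515, 13, 25, 49, 97, 193, 385, 769, 22, 42, 266, 50, 322, 578, 76, 532, 164, 548, 196, 280,
    168, 584, 648, 400, 656, 352, 800],
    682662203825673730392679431599627000881652339513014528, [
    151669693306193354748864, 151139366281674030910652, 151171645833103291516062,
    151309999795751706971876, 151184327971851886161888, 151271950006204166610888,
    151047131438699414055013, 151158965950547191687333, 151155503808336804510145,
    151050587952514139847265, 151266186526776826034656, 151497927125807305379020,
    151256962025544749784472, 151371103510697647042500, 152084761925362284287432,
    151105931559137260144829, 150977961770227029315132, 151229293036431460814056,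
    151275409894420464829662, 151427597790323255828456, 151194704263196535195294,
    151245431687897325545414, 150943367377384756226805, 151299620127812280683477,
    151141671000980751911164, 151187785612665892678613, 151197010106205681845918,
    151403383064321300494465, 151323834846114831209528, 152015593382787127215576,
    151157810776146480745644, 151119764366493322528805, 151222374381504985878472,
    151049437280610592114797, 151494468362392224423112, 151179716284733952187552,
    151180868082536593095041, 151209692246051704830145, 151311152717256305438436,
    151607456924941208800744, 150977943762436330922835, 152638169870484105696648,
    143507004371729690595361, 151188939657870309883360, 151259267868554231913624,
    151056354809637696850029, 151039059858970742048809, 151137060438664280346300,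
    151231597755740876475341, 151235056520254680255437, 151226986069719279007873,
    151343433392388294860008, 150962967037466589993016, 151407996993352038384862,
    150093661957985127041073, 152934487606540232056256, 148806974502078951391262,
    151116305600881191879740, 151185479767457657845696, 151054047840729649531501,
    151059812447154312972861, 151185479768555154700545, 151183176176246118435044,
    151210845167556278155457, 151240820001875661814144, 151185479769656681079765,
    151260420791158085554136, 151266185398681115598808, 151047131437600975637101,
    151063272338665346320485, 151001013452616189094629, 151056354808539862403133,
    151185479769653659629825, 151282327427842394062816, 151160118872051735685281,
    151323830352405438527744, 150934145124655101772350, 151192397301982888471509,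
    151295008439594822716364, 151307692822449396909278, 151531357343645744878728,
    151115154933370990717093, 151235056521349998344321, 151441429468484642837962,
    151599379712418628883586, 150785417132350176766709, 151029838737632042895400,
    151462178674572129834250, 151577480963623745506540, 151877246178820692466720,
    151393011261192744539160, 150746213286609538974270, 151808059633953923454344,
    151462176424973880628626, 151461034755865396970650, 150730071258538963842050,
    150897246017994942478369, 151751572110822890049480, 150634381023254132240418,
    151202782599414371084449, 150359983446767781216318, 150958341842861262280466,
    150770440409581072173165, 151746945776023121925130, 150977957243538633610248,
    153883314947001919575066]⟩

/-- A realization of the surface number 18. -/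
def template18 : Template :=
  ⟨[
    7, 515, 13, 25, 49, 97, 193, 385, 769, 22, 42, 74, 274, 290, 194, 642, 44, 148, 100, 580, 644,
    152, 328, 392, 560, 336, 592, 800],
    29446431920625206988950774147794837097143467207472975, [
    151165881226678662793276, 151281177878539967236237, 152658915721959921292600,
    151169341115992885790869, 150845369043996153077895, 150489100551853850783811,
    144841995212041247305616, 151186632688962531628154, 151768874943871533908007,
    151335362940757341045822, 151295009562197268042043, 151105929308437025153191,
    151157810777243777919077, 151228140114925776226349, 151293860018385941635125,
    151103623466525142051013, 151216612022483227085980, 151296163611793294256224,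
    152957550546802264905769, 153972213656180164774028, 151143974592192297770808,
    151048283232108177334967, 151221223709600126011421, 151290397876179377000763,
    151087485936568664927125, 151183173925545809171560, 151261574838561526448187,
    151215457976179432687933, 151183175049248841072956, 150906473884840632607399,
    151231598880536960855140, 151348048455002376570933, 149573675218001109249540,
    151036754015962597548423, 151184329097749659066407, 151267339444987192607550,
    151173952804207173986341, 150909932649354184975015, 151214306178375575260556,
    150952592994626519540103, 151085180093559417678773, 151432209475246467125691,
    151358423625940318699623, 150346136031283194949698, 154335310905987978631224,
    151169339991192515857420, 151179716285832381757537, 151085176719157695211909,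
    151222376631104699336733, 151323833725709129305128, 151217764943987968150556,
    151333057097748128399422, 151233904723546178743392, 151039062108572870092949,
    151342281597878543532079, 151449507792620212521372, 151652420863626845098171,
    150342688507082045712517, 150403791114794592690241, 151788435224965094202952,
    151168187069687892216876, 151134751220155577079610, 151138209984669263533882,
    151111693914862630019509, 151101316497618135572583, 151182022128841596500064,
    151239669329971853085732, 151226988317123126741005, 151183176176245236572215,
    151084024923551435663493, 151236211691356876120101, 151233905848347643551799,
    151157810778341179811905, 151164728308469506769019, 151284636644152351459381,
    151342280468687619818812, 151296163607403833787197, 151298469450413045386045,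
    151349202500209083230245, 151364187102077153118525, 151288093161260000898116,
    150830382189236658987431, 150831535110740763042183, 151001016823719899537557,
    150999863902215290593431, 150776194878518543590055, 151478329712022369814564,
    151441433974274155038761, 151428750710733182931387, 150826924549522697314727,
    151306543274246162451612, 151496774206503873478843, 150569810670201280193474,
    150971043113102507319701, 151429909252937491646476, 150806153962339252197186,
    150795782172392409821795, 151271936505301149343296, 151480619802337357209192,
    151896832349005762663546, 151771158274402188401752, 150712784197945047967749,
    151162443835571383894197, 150317339986685883130279, 150074072427706391208631,
    150894937901223284674440, 151639713973771096446568, 152589759568683863179707,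
    152051342973080087456772, 149306182820807213118656, 153729965179549688438024,
    151103679760375917314231, 144475363967920452436947, 151427600043211911752740,
    150749684431615697723543, 150582505189442305925815]⟩

/-- A realization of the surface number 19. -/
def template19 : Template :=
  ⟨[
    7, 515, 13, 25, 49, 97, 193, 385, 769, 22, 42, 138, 50, 322, 578, 386, 76, 276, 164, 292, 196,
    152, 552, 584, 656, 784, 352, 672],
    1100333611482097541841791431829192559635270732646191488, [
    151198163027710456436250, 151067888519489450344508, 151183175055842689970144,
    151236213938762381855932, 151192398423483658313672, 151130142909635834285180,
    151149739199715332167322, 151179715159934621513666, 151123222007306250156993,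
    151261575963359769767188, 151323833725709128544016, 151142822799882944802756,
    151135906395654600150884, 151235059892456977141308, 151512916229070292029084,
    151123222006207813278696, 151120917286899485050044, 151195856063198142715848,
    151094404592593545201916, 151198163029908237852664, 151200471122517168623228,
    151258114948148935169562, 151110542120354226817349, 151109389198849611581773,
    151270799336496152358724, 151388398455867283058196, 151163561878383206151810,
    152647392134212549121626, 151153200214928381447420, 151256962026644261213786,
    151145129764395126754620, 151157810778344362397644, 151324986647213731200784,
    151255812481737178647900, 152069786380149901512648, 151245432812696638627792,
    151209692241657919379002, 151271956757204068207740, 151170496295888058609508,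
    151041345429208718225554, 153082067169958110201560, 151185479767457924314690,
    151197010108403633100792, 151103623463229796091932, 151054047837431123642389,
    151018308396688276719805, 151231601127943022382780, 151373410474112430966430,
    151087484812862396794893, 151881856743341683805784, 149733929056467831029923,
    151119763241694010545129, 151120916163198598536169, 151122070209502527491452,
    151115151555674494921537, 151188938531971545888256, 151182021004043346827210,
    151111695040761462000124, 151146282685899666558268, 151246585734201371311952,
    151190091455675139905482, 151089789531074553710717, 151115151558973029633001,
    151133601674150998705404, 151183175045950305444884, 151305384730937545375296,
    151239667080374299695042, 151140516956873697554404, 151304231810532164812752,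
    151207386398648839771706, 151211998084667166627354, 151330749004039760287250,
    151119766618289907353932, 151116308976382289118462, 151235055397653350211520,
    151301929340824826678844, 151117460773082776669468, 151065579304276997310589,
    151240825629174594145628, 151258118326943276518724, 151224684724812167908636,
    151278866415928989472712, 150836145673056276711789, 151114003135566228113740,
    151549810845310668418388, 151212002586065726407740, 151122073589397646756205,
    151462186563559456018264, 151100168075311905999116, 151094404592591397849212,
    151583244441951830185560, 151721602901599135894556, 151411451260867629291226,
    151675475918216212029264, 151089795157270118140220, 151077114144423614875772,
    150982563308860031868946, 150271199502391038404865, 152140117917964846673220,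
    151095538377117605892786, 150629772701741278494773, 152309597374762851929624,
    152020190449699280582146, 149843472364184114118829, 153227342038209170476308,
    148123253822028660109539, 151351439711705830259200, 151045975127404620800006,
    151090949203580422718972, 151118610337780513905641, 151088644485371870577918,
    151826516511115450756372]⟩

/-- A realization of the surface number 20. -/
def template20 : Template :=
  ⟨[
    7, 515, 13, 25, 49, 97, 193, 385, 769, 22, 42, 74, 146, 546, 322, 386, 76, 532, 196, 644, 280,
    168, 648, 776, 176, 336, 592, 608],
    664056124041023767593189538124334571607158586043255164, [
    151258113822250118691489, 150090196427104250351883, 152956414477552090239529,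
    151201621795519424497788, 151252351467622039980117, 151439124753569645128261,
    151419529586097575304041, 152276191921185285390406, 154284682478024194408459,
    151175103473915121167556, 151127834817025562035278, 151132447627845474849131,
    151157810775048512041251, 151251197419120153229921, 151239668202976988715689,
    151165883477377890107407, 151437971833163375585877, 151173952803109744853069,
    151372254179302895843521, 151361883511960353294349, 151088638860271255425339,
    151273105176211109671459, 150876499050520983077150, 150853440619330428141867,
    151329599456937471204137, 151020613123687752009342, 150244677800899802900370,
    151202774715925592418421, 151231597756837284548220, 151331900798548094294713,
    154893287762863262066880, 151108234026646850243836, 151134753470854671782251,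
    151191246626779698432637, 151207389777442569707527, 151200468872916915071093,
    151067881775082976969852, 151103625715031218459003, 151259270119254267482665,
    151440277676172555758165, 151240823374081053118499, 151529053757928280336965,
    151441431719184466991777, 151409147665257758792353, 151365341149480058245993,
    151326144070115723829253, 150424535824995703065820, 151321543604644098560259,
    146556470558517566199562, 151132446503043997811782, 151137059313863952585003,
    151215456851378903014057, 151207387527842852931677, 151228141240824610342988,
    151316918447380787808261, 151207386398648705481473, 151693920408288862468225,
    151018307280678806488702, 151408000367753492394019, 151704315837719908352077,
    152672758673379180685428, 151092094249284378170171, 151185480892258252511785,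
    151160115495453678374132, 151161268416958276840692, 151130141784836248568187,
    151131294706340851224955, 151253503262129400478273, 151193553593489528148011,
    151273105178408522242153, 151185480891159623586721, 151375712943816850602049,
    151251200794621454209323, 151055203011835097383247, 151212001463460998144006,
    151363036433464901486597, 151280022706338262113065, 151331903049247607560873,
    151228142366723460204620, 151254660685031361470467, 150870734442997981315359,
    150874193207511768334623, 151296166985097123184643, 151344588562396394705451,
    151300775292323024296481, 151648955343709289118336, 151291551919186416988673,
    151424137895518192868025, 151425290817022548318889, 151379179585228623560713,
    150990636038668603884798, 151467952289292522445353, 150286200979568654877499,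
    150931826905542417558660, 151594774782897954232937, 151304232926542641231873,
    151644357165191411139197, 151157793897543956294784, 151990213362475976653504,
    151692768628063442046068, 151738907984251185971276, 152107838357762195084137,
    150958361006218478223998, 152336121303886587228161, 150452181170245015178232,
    151182001818709515172224, 151069038079779492201086, 151402239141219587311629]⟩

/-- Realizations of the 20 orientable surfaces with 10 vertices and Euler characteristic `-4`. -/
def templates : List Template := [
  template1, template2, template3, template4, template5, template6, template7, template8,
  template9, template10, template11, template12, template13, template14, template15, template16,
  template17, template18, template19, template20]

/-- Advice for the searches, one number for each irreducible root. -/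
def advice : List ℕ := [
  3411173109500176755681884834946668877734601441382774018148977692676123917448828899609991982582256757918033,
  860855684461270591845172170444772913551620382538335671557471686502958214198894916681951643857,
  40656181815641621509442243529356105786883594526977028133812955126195259696509064252088461438446730297782334306807351088242876665457202254298458923406924202673472539023,
  1294684999422983391497041051170725103235724276665430591569,
  13177033489041569900227836490099207919827893013295333625264172324830452247587761656648568179700812624197643136091318415,
  7595813180440727514349807201426926606123841054284277891735503306880568889439189066328680856278320508625398057104,
  795390932505888547598421582895114383207757636380608154808395248824026326924361213084591879767205090648204266178449,
  86199791547730489350629387832437381171932300271712983846956371576253835485318732373893753096273,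
  420224901726403856123177724040562273012549587803525829713890823920692166772218283181650630019181556767354123450434330364238645329,
  1040476855398552972329820050158320907637855879918069380797657432129595173222804264645602567794272167763803966491158172469409053672504847085707785045437171793,
  32925008574701204944858496751917715421063513191425364853579005638007047019331526911592337,
  360587466606270045764394104019301564127932929792004218919604679361406970879798666001005155333167910815566033,
  7596151840563174200020489932433065862279163735147869714697182294471104839981375664433642408038770316269197197825608402559436509677331,
  37325318473249887943349683879108057585584317869975951081484065212497,
  97142720760871959363306754694591729686650121643605201846233209349330508619118545726825391512799,
  7942302686582086892277336374763406741430349413825675457004108680414723225389371569633454339200677647370886184568473448875498662135094100206105858469556396576485702118467676304,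
  1494978934438759820519001637910568609065130014541518535723806153298830768897402982645158363686729293613387105641495801958827078996883293224754824766755735699,
  51755737350089027779115150511494503634076357310483795995739539853817239388759924717366428042998211493235694801,
  30621936014268609985352749883617888089625097048951816568463138154347156929478723271563958043310010478859144606083825105736147,
  92821139851064620768201657175367165127101761963740919815500970559269114765134677750647707105273940072409443488597167916688977346634039104946702847452486815275032419112362577,
  74589522147515669794581687921786418713090549393389707446956117308004356581506807966091182929845986077959766702186763958232020019344,
  9906490091264653421270933595909800432304829737583818308099312077774932877881371620306617882624921943847922194812005012913402656777105,
  8133305833909384409612420588658086738101241098530480937811819339460210849308499049627413707476531804580805492925827254767613761381300423771869288256006343,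
  45706718916367838635641025551555735283141667247330475430610834419311808254029097782940348008111754808175380720714289759443543571103742362498016789303838770201819189262521699227198335060310586897305915788724242620700496165420651029232904409761604,
  2408194503898337256760587914459117636059772681013141306331925739910307620853834416179428712389908984518833912652043512976501313262912964815069793459214250372540558,
  16945618287040676268200596520656689881045826534479387928473069773455394504242006305103329901641464013833263969848580663210259353055044815283,
  2281080823054294778706717208516209884640890487788001099167852995327539417789606411642939171535745424578430690911673456422,
  4551566000808102915935017687542202080083235052391891102769846159014338683690753385805332386707170015006634877099475162416152928638317418255205296035,
  1386731873496494631490147529617805024826796918110356509879500988238759583126534295457019731116747728748813982720249508141185396983766021153199339535841887642227048289187711502771,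
  2441657500240240415913305733015758064051286407617870102670863185460333403237395133644449674343817173893709558230389113574822647481879793526675310473353597712175976388830925966153317981319675236642591011656923546800199520,
  60685206917949074788052380426314551014050735534351315279315143493657221331754295028052254328590950044647682164610557278917353198490688274713241397988648696441499463087286865718960631075268,
  1806089758666321918184702686843048612226326005383460111699946553590325192243022902615163188976709068830009599864446617380110080687083141988168929271909800941077068718418502946901017647965627696273459,
  450302125302222585247323783988530877933150971754789904555132353830585503726129326852745026268629948466243766,
  19699578843766321953959535933669648232847697643813609735342681654966340698918611123,
  88260713854907903680497908941497970128603522879507620425186427600913224652187736598630200368932487160996904528316814,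
  580701545671571702885664784395624954467332904407846640125804462315816268426492340258361057249780958862135787515954823137204259215,
  49686373232320596797934184549897949386400890314853259624814880541153857968938629826235803473469072208298940640392447598363272267539,
  59010992396071154838064211007964425295872865986782617864202064593870375999630283225168383221816342327385034716391173309044026081064010043615368723716005,
  319190380337099002924947632911109710648777724541275047695173780688676250455346281687937549975696761914837747254762349343903668053542935065068411634494656875900166717,
  63908519730544174916890601386468813967649843315970590623890455822787278762293191946017181020576237603710806102155063648937358048146208146956263203538830,
  21554105350364695766283404443533910682701719612951603475297378227954499730794211921773380767859543059640910369222467256446110589627626278952983050494461462238293585042630093891230095,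
  299017118624690831070832774127348674929608464,
  130612985799414967600831043069152945919238772466882155268054486621851402168816199038586063210342087396449219099692508,
  84156331943775471307357585289798041177123777745599186923962347007427039865468458715419445940647509185529233460085801602551321135173552245989067958309071395811995343276181585,
  4439078653963978738461749209216260294033083777711203095084765966432118571388714688595329635128070018118615656318191196663867441618131598203585725076566272433455113237378500098787635556863608365867246079580,
  64852301715057965060137749779903435366869528731274028840398119744002856560512468913261868806935179854235286723688268299642220582694,
  638309472376652852886434232757801028195962680473281465051389469919727635603959797324226618563680782848394807296104490545562007667370102910006406648831483311141680264992560,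
  457142924692062297117737985443523802897162047850613852396755010838555103424900323961851824043946999819274068,
  838722182022660110535596214212124709615930198532505273930961189182793608429739505793504505291235715210241233918801,
  89362162489797729676266226480662132282638145065182963317941779406927997935362126130349474434385090854682130094826012,
  124552680688161075708125760742209222955342988038595955657021384254747857707924100583908673298641230123430344186363651021066317442111948604388356519538276527648,
  253480541793021702838767773404550481036232615149662370453916795805372853771074242805608577562514865504935383422290560790594294981199258117050805,
  61224233692078766261093179024273955671728777814735057709958865015356969029245330156188952567862550942987204022530379029434181594258245001535251953890990757379256147915403859429024873419199,
  118598940085803003285944540895626488720357962988135032426756082783627731154504255871779955803684677638423220651890167093472267885843105686385012454820520721719255111601367594773997942122833071707509120890867247172880,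
  6740384787780195477217804971136829301846694796180172707221984702832973314617114244997008315306195047665839908751443423010101701694182415034770378946660507,
  3255165973186944334865655236092797407855106292794899561963695540065577790386362816911,
  37345770899810810899252611054517443252765902842000180693161882227908247176003079067424678665428502518034069332437246571707997262612235183685816783,
  35548562451343014668349533799746619918941691561067137216057498007100647579515447324711256591776185225046725605389523372703414227147386439533336358,
  387930669471654043766470514073469999896229654097114698928964143847118980719859615609199376708905579408482881,
  224089823556926361292770969675628717568619321007228244615142385100906995623778810203697646464277931572311774792219211179131148663662273560678556566426403747896825968023363540764718,
  1716246623864784134559367107336467594746479439356421607228848198475145568670834875083857855571967280052464328941927325659064422893218561319854,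
  1822674647766426069077662287733569395585307754866480171869134439211769775044402841162531352879916198,
  41490995018634623897936744874892898363455263798791810203982806182422178538740584847671207516757516289111841420605159067289460618405691361355344190963031610438701001617,
  48773534267415067269144427607093045585425602673427650016733439336666366502936094874014374,
  5694893278911837404472700202757098132283127737911717737096479857416668331854054232866357273135896901382298964686246413758533669295245976123813140191378473390012738573095,
  1565540385715849331609430052391084453283307708249496296878714549765857477942353268158580844362010728377262672625661448997,
  47716245409720662186628280961174135083103895624206882268190847522339669208972187365368218499163619156366985681311844832898664515772200752360680876291032872507331416743,
  706294729788840756272334378536717831132952132053300007228661877584869226108290868447178434587596330118494192018273105932963296222251214884730433534438748253449446327119525,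
  3263731636347367492780792174721432903426639220491752712193032455043986889492911518954355075827864892918317171298736618886238755,
  779051214884125399548219496653680286250990083001754346411693037754516312756973963283659983943,
  8086434141549237111955038135987874994126472112879557379255646023666004212007927941450984471648418857376953960657,
  112238104212783448507646951742101778746587484526518729233854295125026590452642587094898994889530088423564913083156877,
  799042688010409892212836685423594565145161742035596730097455507801064099471241315099914397870,
  14771886824057886893489737570910525610133469280293959727675810601001584459590059984178322695168682605593919075646266554,
  99680871289663496621733421952492150930601423522260808826524868858832270438430333911729330792592,
  183093142291929627870343117318351761136268064423812181902383804504586092720938129,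
  241084248957429258974858352169072987496962470368641641401855273101,
  21423185962864400741416857477753571810876990109072450041011345,
  2293737142568426869163577785086612567312025963294773996648454918052769664401107656420621951960246153751342620540042525434393967876044772960864131059834815880369994,
  1180738459664947712350314952267810964174169015884314878192037498651120272451769,
  8532716430530887699628242232450196025047423399483903170711794218382070134561861142063613191036208766841196833344724606507385885366112,
  97619414236544163069173011943532155511427221672683289663399104250860840275580835268118198831505,
  153869285067625680071745094764980229945747487859408481350794529881110692492501522,
  41989942861662676560148487540202747434692952059672984563244509577195830612058541072938424302174336811005450965413160160138232441924340700688967821,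
  30774208335218291480870517597533570938039401490752295097466907216455467481427036740826490996662074052961848030324585394366613,
  736013312168124912260956278687474583749066761133206885752386897035184269,
  34363292077867807607112428274775404967978967495266677765643071478993,
  9700492203677281893532313552579140288034433696191840346873331530673920545351164680678466049147611043778863409698990703200949312995666757189742468941993812,
  21984880438404519051339665890094937935316194588717383599095350918143477649322690959,
  73180958429660950715627725215017784154488650953396128612227257296065535680703973991124816291242212154083658517133252896294793652373,
  14668705794189969245117930630031588740729155537099307355865943053818631819606129166517166552826026549108743962737960239,
  11095928223705971404950625461481431682846768699536960039010336557456581511565,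
  736811265259468894821705693640252988727890907912347276493303995444059481393159106404211131332152650660658617059389,
  47909235608425969382195953675077379275855626220247317402728083817088078045262450596919544566844044661943052217,
  1641875997042295415678866371603029011646408531780125509397081837234797466992561449055456533033697564914658689517863878219532419661650586658728049097676624447589101644565212567473,
  5943961134810581764151162312659717700547252739734303191810874914805744323500593746673128696399244961619299949304973328699418502174238396215870093387345616421572883534356999883578310501242512156996647169707459467810101620091965927447323888329359240592254961280691611563498011429441333568566,
  521863590000823362746898841570564158330373325360419003238812318105367997437492238917835802265575594582462206558595507618944350248695991466914958526096,
  2535487889249140717490178264287950420668691586373393976475737744,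
  65823881249003863240136074424722780388096199639283415093107553963151990185990549720871589118455545494695778132,
  452596178393410454699851408855100624921865940224688655071008118217045310462155641133922907627422330040625712,
  146180563251417334449506238262283125333863326341279836759766158585527893136765737927148637544606604649395992228519361009695194939605325662,
  6793464471128301469227579683205047724302599372233136216179783061845483815304466324016232933544342948027492903921710416835773247231407,
  7182227281202405262634664190870793158712955311649509219627240360403403663228843901974125684515860282592371084309,
  6243262599380362217850460993855133659402128564758997835765604067037187935128600724026135900,
  200388841115393926610356801327601493309346770332235910197543219481544374967402433240422311449621050754115789871090688625085,
  737887717744598867224158306787623761737717882364061007120616630934190139848483137869671393465,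
  1877186124906730816027316319466192607175435276674422607695414751800694526252632716756018693596933840321660318981947612656525332871829827357995,
  94220366211675713018583212325783816614595449667410836588158961195743005742,
  291510021777434869588461052925263005302231700053608433967103102898332566265136693979653286731396105417382128047904111695601306154957626246711205,
  137994926235306495884964046163247963577573921178085131709403205399855648523378758446287385393756319050000672697542620,
  1454349099983613153616333688717326386676648769178386419596313199155119961701337080492904124458035374,
  531027809516513141326325318489260699529415656347475451125881909432237658285971487761722422143605859018236137329613898245251470616,
  127521302873079549945534213826430730072470490263452182440058394513706815042292038154002995926839172540011195751147063026726949686654322321,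
  452863352006720395209123859242472308031277862320557183968843708016441486800042611041542249969571130067535643214646855257855838355,
  151124080766407761416261834284954393721809318675707742671307250781625202665839761,
  226394081515601783034715447212142374121212266787504420213520686176207676140786673626855007306196166976825830830926250448673384201302771538294984420401035856288484835639961113284156481688044926422374351,
  34265458949401864192704210290109487713861054971555481085828654263432446422722208896393037485142557742130485470088283221470000,
  28787317099321881242031256875858911666421505143485456529509629873384374853174053922975611882640113673350015141540692838844063,
  2030672288550547874515161976306701161958198384174682891459663204712487222416299710774040937914814797028593091493038118214335960475328562926820214854727457676650179125946611576310173254869535292307240311120440344107735398023025883218083790430778055143831072593974,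
  181896488840445792001431202634249606195918865615642358100097567597446166638858125,
  246212780736044117540059214835297427795319870641017374301950226557955942962336101229082426937401071640,
  14347253827383922200109681260935182372126607980034313113156258493351194069267287327190055300768922614786100251117930364935909582137882593105,
  1633715961041769954424053652993567297273243336469475391542138694522667251858003212919932260325350586,
  1204640180400397238351351773682015434119679584628148725713358062921740478725602513375585578957596535380065014407963379945554066445452974,
  35519137396227046424425868872314294490462447860633605973641631772223729913753558296912655674762642617048162999578573263040994071723428355820311756063238720712299800725,
  357740231993216977931008839076506245611245193326968393140814629671173926529583981559387015035535256232840230765965863689387269571997733598997032265249502631253095354085912345039701911824535395465508285606029,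
  3250824234405907622857629374708820022849231445697815847261196419477423514181085466509,
  4319383636254685023802009741,
  43744459265218334509395845236687973789374682332461204129968354945057663777442119763717247327836078789358790271360977174728528846176739347931548329,
  204842461293054254165524624641889417889782574522227812600041196872306222705097838290441057285010529462,
  79051030108584304811933097345500624041138615384066061,
  34982114860158871648899038269218157143884921088215913874624953065503319185688279943918654656309088958083189922443284358416019,
  6245479169405968426751040373420880894869178466424621659330606700925185156491266037681424397,
  977716002593312215938842755812576921060301449975949386607732271015994376926828698686946784807065287009523493802765,
  13185278188003625668228759412679318916342732816912867160528911836009893647599858153651917157566861,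
  1737567635120944466792245921452293349382036422593650629950320893412701322786756336864195848647993741,
  7528238729858358832125977625634468692698976807608914916163553833944240509325,
  97652734971861405423654782195441733052376740167438508294747867699255845981350132818030608806628776346786561212219487651191899804819016108815574376084188384236136340599950812,
  3705074495282568662526011497511870250397478772474632841269202264368886728399888154330101083526425460930327698234010190614694556,
  2895442074197491655697918247473449022586303803658449403052399771,
  626906371113623660233399001806547419678326175907129474905999059856373229608742091607900810680641193208878475514433298388283171024943954583269654597013,
  11689654353390694060229751272435423810725714288347187662018267037103230752460903252871695995591866,
  47418742095165220208344033327748725711496656953593594807216501510585,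
  99680768477843111800953339930405455070986381027618609912363241382977290195763418893782985492493,
  2491516441774065968314539366699034255019918629278537259765571674798487988672040545079069835165690384045892,
  6846050247524286685238701298595720369020332414905155145124194530676551657591863335792117452070965196345945428025,
  21498012052611347070789982982401298586902921228068246454871621119205440478673880739,
  3215702561298477267096690436086772735429647340009057194446612216535615843979566106455065024691548193454018878655681415636578325966171563362321907651794570045310493524239205549759254593235269682069125719481,
  28277090745039281453088134511161907990410277271287989575605318346606322632589881072549899672890214393609510340109376525588632,
  9686067926172297970068876141646048049071004385673333190426313938452729116528846690358854995452454,
  324702583927249987744374491008618166560162802007422419993728101539757967051000595571235,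
  1633169713762048857027270429144252724199201644322387065810024671264579972767537465635841841045021197,
  43792919547176102383463260103574509823224306071311191986500950899945780204087679979381713,
  29311290958126315088965787825524986407170048937208472697185671006919306344115151379687629365584973602243516682488704328634253,
  82256316758718299292464299704302600222471090648312178788359270497249364365,
  2172122034459000993353208436559155250156751044642145405031898731647548844533627477133,
  8024743622510060621485248728396583639495696209794025229,
  2086522254340473075776883219499355529080809601388567545620846411165557282737614067327821859322747313232642644820296433105204381849637445929357,
  61116144970992322313962186460505374605516930276399142704578673794095554308785873469870236324347113463554404151998734535135687038094,
  576659503927972977336376576043454099431537798006541,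
  4148972275422707799240917513719114385259555430263375411234819199352826925473916870291932922428830355116446113880151863585082773,
  153043256977629220873244765891188545293010085113712311784143607003094134527488313695439890796251773608375922373428407163671356759638989146963290000503678835653622914714132796982728537291158120826007182042051949270908292483374030669630142,
  3193267286147133690995679463030595775641373518339938748491894634388095909643002069134871313235971761106324736766121931657880686511842362726801131235976411439594689642686667303539665326,
  30478503629036526163920585346782157482606297011702379999831592067512942772470813233696117731824311051438074287942086340368336982173197340435876109,
  75538776193701646528080270024753247727546062387464593308541458132562116829045703863071412197728050365514868559517275246896062842145205551841439371802675661745172032358724174812657648408576122864878148884986525157380647861639507764245785189826941213028324726401197110070907891171513280085199302126223558466701,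
  3471454556266745677170817651703989546916734752347561422129741276702190750927770269186939883631448021943802591513990408878639816,
  1062547780331435603607912643110744954821214282872303691617766213571601884480518725982484927142198236835990868597007926038807935258682460,
  146260199211519861992457517323505056627981658773176319520692609213460066242354812774191857841270720058301838717293676794888332575314926757,
  13314619575786834982312001544061750102914943033630908974282006088461438480709083803972994678120850246967175812409993612501617749187141274901,
  15361839246390435968644274532463181604717528127673413799021053293637542164260365484324275535315451463543606820622258953912888721041215198350,
  38395214793747815746875132509941712387567704464864827426497207519161,
  13436018669852667116612056925560775333664820962992289797276308204220746436276218485319618425423545,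
  115315812611410678899746071836072140165787907957879747918166349178117590554392719263768658659460957509552396011033420,
  523457728210497883655535260521566196765373243781790648847236994377974641830317823463577342329831281467970389949577137387196584752,
  36509243142935942584421014770948625726335414759585323151512492192165334119298357333069888338676042239637677311547211390795842080109170194015761271335292606970632274296860199286185813503451304544658363116264739287988536658848225129523411724781488,
  37670709813063587737129022377141592135721173302275759742194635657950760127277668622634673609514715393827650490021624807437627492560057677168211710009957725980888421296250413080098122441254,
  235157486688245088137992104228193813135439010008539237003079466703168004167131240875644864585790894867869765457915282709155,
  1248400442254031322635885629288735800425260871628545068770994799091121873479165607617652129879182378229669696654310404798736733707147190305808301138066508884,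
  4241548487418402715656233127651655612568564683387956629404831931650504828336266089011575011451863166280585220143947388101823191,
  288248776288690596122904871338237472606799460324444831568997962363215986764948441273747991471320397287905600775795321875678380171956999732552230,
  1959771919235823161229,
  6950151675757175620184964894792514225572192480610312717]

set_option maxRecDepth 100000 in
theorem templates_ok : ∀ T ∈ templates, Template.ok T = true := by
  rw [← List.all_eq_true]; decide +kernel

theorem roots_ok : rootsOK (templates.map Template.tris) (choose 3 chords) advice = true := by
  decide +kernel

end TriSearch

/-- Hougardy–Lutz–Zelke: every orientable triangulated surface with 10 vertices and
Euler characteristic -4 (each of the 20 vertex-minimal triangulations of the orientable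
surface of genus 3) admits a geometric realization in ℝ³. -/
theorem genus_three_10_vertices_realizable (S : TriSurface 10)
    (ho : S.Orientable) (hχ : S.eulerChar = -4) :
    ∃ p : Fin 10 → (Fin 3 → ℝ), S.IsRealization p := by
  obtain ⟨ω, h₁, h₂⟩ := ho
  exact TriSearch.exists_realization ⟨h₁, h₂⟩ hχ TriSearch.templates_ok TriSearch.roots_ok
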